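/- Let (P_t)_{t≥0} be a Markov–Feller semigroup on a Polish space X that is Cesàro eventually continuous on X, and suppose there exists z ∈ X such that for every x ∈ X and every ε > 0, limsup_{t→∞} Q_t(x, B(z, ε)) > 0. Then (P_t) admits a unique invariant probability measure μ*; moreover z ∈ supp μ*, and for every Borel probability measure ν with supp ν ⊆ T, Q_t ν converges weakly to μ* as t → ∞. -/

import Mathlib

open MeasureTheory Filter Metric Set Topology
open scoped ENNReal

/-- A Markov–Feller semigroup on a metric measurable space `X`: a family of Markov
kernels `P t` (for `t ≥ 0`) such that `P 0` is the identity kernel, the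
Chapman–Kolmogorov semigroup property holds, `x ↦ ∫ f d(P t x)` is continuous for
every bounded continuous `f` (Feller property), and `t ↦ ∫ f d(P t x)` is Borel
measurable. -/
structure MarkovFellerSemigroup (X : Type*) [MetricSpace X] [MeasurableSpace X]
    [BorelSpace X] where
  P : ℝ → X → Measure X
  isProb : ∀ t, 0 ≤ t → ∀ x, IsProbabilityMeasure (P t x)
  measurable_x : ∀ t, 0 ≤ t → Measurable (P t)
  id0 : ∀ x, P 0 x = Measure.dirac x
  semigroup : ∀ s t : ℝ, 0 ≤ s → 0 ≤ t → ∀ x, P (t + s) x = (P t x).bind (P s)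
  feller : ∀ (f : BoundedContinuousFunction X ℝ) (t : ℝ), 0 ≤ t →
    Continuous fun x => ∫ y, f y ∂ P t x
  measurable_t : ∀ (f : BoundedContinuousFunction X ℝ) (x : X),
    Measurable fun t : ℝ => ∫ y, f y ∂ P t x

namespace MarkovFellerSemigroup

variable {X : Type*} [MetricSpace X] [MeasurableSpace X] [BorelSpace X]

/-- `P_t f (x) = ∫ f(y) P_t(x, dy)`. -/
noncomputable def Pf (S : MarkovFellerSemigroup X) (t : ℝ) (f : X → ℝ) (x : X) : ℝ :=
  ∫ y, f y ∂ S.P t x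

/-- The Cesàro average `Q_t f (x) = (1/t) ∫_0^t P_s f (x) ds`. -/
noncomputable def Qf (S : MarkovFellerSemigroup X) (t : ℝ) (f : X → ℝ) (x : X) : ℝ :=
  (1 / t) * ∫ s in (0:ℝ)..t, S.Pf s f x

/-- The Cesàro average `Q_t(x, A) = (1/t) ∫_0^t P_s(x, A) ds`. -/
noncomputable def Qmeas (S : MarkovFellerSemigroup X) (t : ℝ) (x : X) (A : Set X) : ℝ :=
  (1 / t) * ∫ s in (0:ℝ)..t, (S.P s x A).toReal

/-- The action `P_t μ = ∫ P_t(x, ·) μ(dx)` of the semigroup on measures. -/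
noncomputable def Pmeas (S : MarkovFellerSemigroup X) (t : ℝ) (μ : Measure X) : Measure X :=
  μ.bind (S.P t)

/-- `⟨f, Q_t μ⟩ = (1/t) ∫_0^t ⟨f, P_s μ⟩ ds`. -/
noncomputable def QfM (S : MarkovFellerSemigroup X) (t : ℝ) (f : X → ℝ) (μ : Measure X) : ℝ :=
  (1 / t) * ∫ s in (0:ℝ)..t, ∫ x, S.Pf s f x ∂μ

/-- The set `T` of points `x` for which the family `{Q_t(x,·)}_{t>0}` is tight. -/
def Tset (S : MarkovFellerSemigroup X) : Set X :=
  {x | ∀ ε > (0:ℝ), ∃ K : Set X, IsCompact K ∧ ∀ t > (0:ℝ), 1 - ε ≤ S.Qmeas t x K}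

/-- Bounded Lipschitz real-valued functions, the class `L_b(X)`. -/
def IsBddLipschitz (f : X → ℝ) : Prop :=
  (∃ K, LipschitzWith K f) ∧ ∃ M, ∀ x, |f x| ≤ M

/-- Eventual continuity at `z`: for every bounded Lipschitz `f`,
`limsup_{x → z} limsup_{t → ∞} |P_t f(x) − P_t f(z)| = 0`. -/
def EvContAt (S : MarkovFellerSemigroup X) (z : X) : Prop :=
  ∀ f : X → ℝ, IsBddLipschitz f →
    limsup (fun x => limsup (fun t => |S.Pf t f x - S.Pf t f z|) atTop) (𝓝 z) = 0

/-- Cesàro eventual continuity at `z`: for every bounded Lipschitz `f`,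
`limsup_{x → z} limsup_{t → ∞} |Q_t f(x) − Q_t f(z)| = 0`. -/
def CesaroEvContAt (S : MarkovFellerSemigroup X) (z : X) : Prop :=
  ∀ f : X → ℝ, IsBddLipschitz f →
    limsup (fun x => limsup (fun t => |S.Qf t f x - S.Qf t f z|) atTop) (𝓝 z) = 0

/-- An invariant probability measure of the semigroup. -/
def Invariant (S : MarkovFellerSemigroup X) (μ : Measure X) : Prop :=
  IsProbabilityMeasure μ ∧ ∀ t, 0 ≤ t → S.Pmeas t μ = μ

/-- An ergodic invariant probability measure: an invariant probability measure `μ`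
such that whenever `μ = (1/2)(μ₁ + μ₂)` with `μ₁, μ₂` invariant probability
measures, `μ₁ = μ₂ = μ`. -/
def ErgodicInv (S : MarkovFellerSemigroup X) (μ : Measure X) : Prop :=
  S.Invariant μ ∧ ∀ μ₁ μ₂ : Measure X, S.Invariant μ₁ → S.Invariant μ₂ →
    μ = (2 : ℝ≥0∞)⁻¹ • (μ₁ + μ₂) → μ₁ = μ ∧ μ₂ = μ

/-- The support of a measure: points all of whose balls have positive measure. -/
def msupp (μ : Measure X) : Set X :=
  {x | ∀ ε > (0:ℝ), 0 < μ (ball x ε)}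

/-- `Q_t(x,·)` converges weakly to `μ` as `t → ∞`. -/
def QWeakLim (S : MarkovFellerSemigroup X) (x : X) (μ : Measure X) : Prop :=
  ∀ f : BoundedContinuousFunction X ℝ,
    Tendsto (fun t => S.Qf t f x) atTop (𝓝 (∫ y, f y ∂μ))

/-- `Q_t ν` converges weakly to `μ` as `t → ∞`. -/
def QWeakLimM (S : MarkovFellerSemigroup X) (ν : Measure X) (μ : Measure X) : Prop :=
  ∀ f : BoundedContinuousFunction X ℝ,
    Tendsto (fun t => S.QfM t f ν) atTop (𝓝 (∫ y, f y ∂μ))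

end MarkovFellerSemigroup

namespace MarkovFellerSemigroup

open ProbabilityTheory BoundedContinuousFunction

section Helpers

variable {X : Type*} [MetricSpace X] [CompleteSpace X]
  [TopologicalSpace.SeparableSpace X] [MeasurableSpace X] [BorelSpace X]

lemma integral_bind_bcf {A : Type*} [MeasurableSpace A] (μ : Measure A) [IsFiniteMeasure μ]
    (k : A → Measure X) (hk : Measurable k) (hp : ∀ a, IsProbabilityMeasure (k a))
    (f : X → ℝ) (hf : Measurable f) (M : ℝ) (hM : ∀ x, |f x| ≤ M) :
    ∫ y, f y ∂(μ.bind k) = ∫ a, ∫ y, f y ∂(k a) ∂μ := by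
  let η : Kernel A X := ⟨k, hk⟩
  have : IsMarkovKernel η := ⟨hp⟩
  have h1 : (η ∘ₖ Kernel.const Unit μ) () = μ.bind k := by
    rw [Kernel.comp_apply]; rfl
  have hfin : IsFiniteMeasure ((η ∘ₖ Kernel.const Unit μ) ()) := inferInstance
  have := Kernel.integral_comp (η := η) (κ := Kernel.const Unit μ) (a := ()) (f := f)
    (Integrable.of_bound hf.aestronglyMeasurable M (ae_of_all _ hM))
  rw [h1] at this
  rw [this]; rfl

/-- the time-extended transition function -/
noncomputable def pk (S : MarkovFellerSemigroup X) (q : ℝ × X) : Measure X :=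
  S.P (max q.1 0) q.2

instance pk_prob (S : MarkovFellerSemigroup X) (q : ℝ × X) : IsProbabilityMeasure (S.pk q) :=
  S.isProb _ (le_max_right _ _) _

lemma pk_measurable_bcf (S : MarkovFellerSemigroup X) (f : X →ᵇ ℝ) :
    Measurable (fun q : ℝ × X => ∫ y, f y ∂(S.pk q)) := by
  have := measurable_uncurry_of_continuous_of_measurable (ι := X) (α := ℝ) (β := ℝ)
    (u := fun x s => ∫ y, f y ∂(S.P (max s 0) x))
    (fun s => S.feller f _ (le_max_right _ _))
    (fun x => (S.measurable_t f x).comp (measurable_id.max measurable_const))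
  exact this.comp measurable_swap

lemma pk_measurable (S : MarkovFellerSemigroup X) : Measurable S.pk := by
  refine Measurable.measure_of_isPiSystem_of_isProbabilityMeasure
    (S := {s : Set X | IsClosed s}) ?_ isPiSystem_isClosed ?_
  · rw [BorelSpace.measurable_eq (α := X), borel_eq_generateFrom_isClosed]
  · intro s hs
    have hr : Measurable fun a => (S.pk a).real s := by
      refine measurable_of_tendsto_metrizable (f := fun (n : ℕ) a => ∫ ω, ((thickenedIndicator
        (δ := (1 : ℝ) / (n + 1)) (by positivity) s ω : NNReal) : ℝ) ∂(S.pk a)) ?_ ?_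
      · intro n
        let g : X →ᵇ ℝ := BoundedContinuousFunction.ofNormedAddCommGroup
          (fun ω => ((thickenedIndicator
            (δ := (1 : ℝ) / (n + 1)) (by positivity) s ω : NNReal) : ℝ))
          (by fun_prop) 1 (fun x => by
            simpa using thickenedIndicator_le_one (δ := (1 : ℝ) / (n + 1)) (by positivity) s x)
        exact S.pk_measurable_bcf g
      · rw [tendsto_pi_nhds]
        intro a
        exact tendsto_integral_thickenedIndicator_of_isClosed (S.pk a) hs
          (δs := fun n ↦ (1 : ℝ) / (n + 1))
          (fun _ ↦ by positivity) tendsto_one_div_add_atTop_nhds_zero_nat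
    have : (fun a => S.pk a s) = fun a => ENNReal.ofReal ((S.pk a).real s) := by
      funext a; simp [Measure.real]
    rw [this]
    exact hr.ennreal_ofReal

/-- uniform probability on `(0,t]` -/
noncomputable def unif (t : ℝ) : Measure ℝ :=
  (ENNReal.ofReal t)⁻¹ • (volume.restrict (Ioc 0 t))

lemma unif_prob {t : ℝ} (ht : 0 < t) : IsProbabilityMeasure (unif t) := by
  constructor
  simp only [unif, Measure.smul_apply, Measure.restrict_apply_univ, Real.volume_Ioc, sub_zero,
    smul_eq_mul]
  exact ENNReal.inv_mul_cancel (by simpa using ht) ENNReal.ofReal_ne_top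

instance unif_fin (t : ℝ) : IsFiniteMeasure (unif t) := by
  by_cases ht : 0 < t
  · have := unif_prob ht
    infer_instance
  · have : unif t = 0 := by
      simp [unif, Ioc_eq_empty ht]
    rw [this]; infer_instance

lemma integral_unif {t : ℝ} (ht : 0 < t) (g : ℝ → ℝ) :
    ∫ s, g s ∂(unif t) = (1 / t) * ∫ s in (0:ℝ)..t, g s := by
  rw [unif, integral_smul_measure, intervalIntegral.integral_of_le ht.le]
  simp [ENNReal.toReal_inv, ENNReal.toReal_ofReal ht.le]

/-- Cesàro averages as measures. -/
noncomputable def Qm (S : MarkovFellerSemigroup X) (t : ℝ) (x : X) : Measure X :=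
  (unif t).bind (fun s => S.pk (s, x))

lemma pk_measurable_left (S : MarkovFellerSemigroup X) (x : X) :
    Measurable (fun s => S.pk (s, x)) :=
  S.pk_measurable.comp (measurable_id.prodMk measurable_const)

lemma pk_of_nonneg (S : MarkovFellerSemigroup X) {s : ℝ} (hs : 0 ≤ s) (x : X) :
    S.pk (s, x) = S.P s x := by simp [pk, hs]

lemma Qm_prob (S : MarkovFellerSemigroup X) {t : ℝ} (ht : 0 < t) (x : X) :
    IsProbabilityMeasure (S.Qm t x) := by
  have := unif_prob ht
  constructor
  rw [Qm, Measure.bind_apply MeasurableSet.univ (S.pk_measurable_left x).aemeasurable]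
  simp

lemma integral_Qm (S : MarkovFellerSemigroup X) {t : ℝ} (ht : 0 < t) (x : X)
    (f : X → ℝ) (hf : Measurable f) (M : ℝ) (hM : ∀ x, |f x| ≤ M) :
    ∫ y, f y ∂(S.Qm t x) = S.Qf t f x := by
  rw [Qm, integral_bind_bcf _ _ (S.pk_measurable_left x) (fun s => S.pk_prob _) f hf M hM,
    integral_unif ht, Qf]
  congr 1
  refine intervalIntegral.integral_congr_ae ?_
  refine ae_of_all _ fun s hs => ?_
  rw [uIoc_of_le ht.le] at hs
  simp only [Pf]
  rw [S.pk_of_nonneg hs.1.le]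

lemma integral_Qm_bcf (S : MarkovFellerSemigroup X) {t : ℝ} (ht : 0 < t) (x : X) (f : X →ᵇ ℝ) :
    ∫ y, f y ∂(S.Qm t x) = S.Qf t f x :=
  S.integral_Qm ht x f f.continuous.measurable ‖f‖ (fun x => f.norm_coe_le_norm x)

lemma Qm_real (S : MarkovFellerSemigroup X) {t : ℝ} (ht : 0 < t) (x : X) {A : Set X}
    (hA : MeasurableSet A) : (S.Qm t x).real A = S.Qmeas t x A := by
  have h := S.integral_Qm ht x (A.indicator 1) (measurable_one.indicator hA) 1 (fun x => by
    by_cases h : x ∈ A <;> simp [h])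
  rw [integral_indicator_one hA] at h
  rw [h, Qf, Qmeas]
  congr 1
  simp only [Pf]
  congr 1
  funext s
  rw [integral_indicator_one hA]; rfl

lemma abs_integral_le (μ : Measure X) [IsProbabilityMeasure μ] (f : X →ᵇ ℝ) :
    |∫ y, f y ∂μ| ≤ ‖f‖ := by
  have := norm_integral_le_of_norm_le_const (μ := μ) (f := f) (C := ‖f‖)
    (ae_of_all _ fun x => f.norm_coe_le_norm x)
  simpa using this

lemma abs_Pf_le (S : MarkovFellerSemigroup X) {s : ℝ} (hs : 0 ≤ s) (x : X) (f : X →ᵇ ℝ) :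
    |S.Pf s f x| ≤ ‖f‖ := by
  have := S.isProb s hs x
  exact abs_integral_le _ f

/-- `P_s f` as a bounded continuous function. -/
noncomputable def PB (S : MarkovFellerSemigroup X) (s : ℝ) (f : X →ᵇ ℝ) : X →ᵇ ℝ :=
  BoundedContinuousFunction.ofNormedAddCommGroup (fun x => ∫ y, f y ∂(S.pk (s, x)))
    (S.feller f _ (le_max_right _ _)) ‖f‖ (fun x => abs_integral_le _ f)

lemma PB_apply (S : MarkovFellerSemigroup X) {s : ℝ} (hs : 0 ≤ s) (f : X →ᵇ ℝ) (x : X) :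
    S.PB s f x = S.Pf s f x := by
  simp [PB, Pf, pk, hs]

/-- `Q_s f` as a bounded continuous function. -/
noncomputable def QB (S : MarkovFellerSemigroup X) (t : ℝ) (ht : 0 < t) (f : X →ᵇ ℝ) : X →ᵇ ℝ :=
  BoundedContinuousFunction.ofNormedAddCommGroup (fun x => ∫ s, S.PB s f x ∂(unif t))
    (by
      refine continuous_of_dominated (bound := fun _ => ‖f‖) ?_ ?_ ?_ ?_
      · intro x
        exact ((S.pk_measurable_bcf f).comp
          (measurable_id.prodMk measurable_const)).aestronglyMeasurable
      · intro x
        exact ae_of_all _ fun s => abs_integral_le (S.pk (s, x)) f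
      · exact integrable_const _
      · exact ae_of_all _ fun s => (S.PB s f).continuous) ‖f‖
    (fun x => by
      have := unif_prob ht
      have := norm_integral_le_of_norm_le_const (μ := unif t) (f := fun s => S.PB s f x)
        (C := ‖f‖) (ae_of_all _ fun s => abs_integral_le (S.pk (s, x)) f)
      simpa using this)

lemma QB_apply (S : MarkovFellerSemigroup X) {t : ℝ} (ht : 0 < t) (f : X →ᵇ ℝ) (x : X) :
    S.QB t ht f x = S.Qf t f x := by
  simp only [QB, BoundedContinuousFunction.coe_ofNormedAddCommGroup]
  rw [integral_unif ht, Qf]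
  congr 1
  refine intervalIntegral.integral_congr_ae (ae_of_all _ fun s hs => ?_)
  rw [uIoc_of_le ht.le] at hs
  exact S.PB_apply hs.1.le f x

lemma continuous_Qf (S : MarkovFellerSemigroup X) {t : ℝ} (ht : 0 < t) (f : X →ᵇ ℝ) :
    Continuous (fun x => S.Qf t f x) := by
  have := (S.QB t ht f).continuous
  refine this.congr fun x => S.QB_apply ht f x

lemma abs_Qf_le (S : MarkovFellerSemigroup X) {t : ℝ} (ht : 0 < t) (x : X) (f : X →ᵇ ℝ) :
    |S.Qf t f x| ≤ ‖f‖ := by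
  have := S.Qm_prob ht x
  rw [← S.integral_Qm_bcf ht]
  exact abs_integral_le _ f

lemma Qf_mono (S : MarkovFellerSemigroup X) {t : ℝ} (ht : 0 < t) (x : X) {f g : X →ᵇ ℝ}
    (h : ∀ y, f y ≤ g y) : S.Qf t f x ≤ S.Qf t g x := by
  have := S.Qm_prob ht x
  rw [← S.integral_Qm_bcf ht, ← S.integral_Qm_bcf ht]
  exact integral_mono (f.integrable _) (g.integrable _) h

lemma Qf_add (S : MarkovFellerSemigroup X) {t : ℝ} (ht : 0 < t) (x : X) (f g : X →ᵇ ℝ) :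
    S.Qf t (f + g : X →ᵇ ℝ) x = S.Qf t f x + S.Qf t g x := by
  have := S.Qm_prob ht x
  rw [← S.integral_Qm_bcf ht, ← S.integral_Qm_bcf ht, ← S.integral_Qm_bcf ht]
  exact integral_add (f.integrable _) (g.integrable _)

lemma Qf_sum (S : MarkovFellerSemigroup X) {t : ℝ} (ht : 0 < t) (x : X) {ι : Type*}
    (J : Finset ι) (f : ι → X →ᵇ ℝ) :
    S.Qf t (∑ i ∈ J, f i : X →ᵇ ℝ) x = ∑ i ∈ J, S.Qf t (f i) x := by
  have := S.Qm_prob ht x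
  simp_rw [← S.integral_Qm_bcf ht]
  rw [← integral_finsetSum _ (fun i _ => (f i).integrable _)]
  simp

/-- Fubini for the Cesàro averages. -/
lemma integral_Qf (S : MarkovFellerSemigroup X) {t : ℝ} (ht : 0 < t) (f : X →ᵇ ℝ)
    (ν : Measure X) [IsProbabilityMeasure ν] :
    ∫ x, S.Qf t f x ∂ν = S.QfM t f ν := by
  have h1 : ∫ x, S.Qf t f x ∂ν = ∫ x, ∫ s, S.PB s f x ∂(unif t) ∂ν := by
    congr 1; funext x; rw [← S.QB_apply ht]; rfl
  rw [h1, integral_integral_swap, integral_unif ht, QfM]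
  · congr 1
    refine intervalIntegral.integral_congr_ae (ae_of_all _ fun s hs => ?_)
    rw [uIoc_of_le ht.le] at hs
    simp only [S.PB_apply hs.1.le]
  · refine Integrable.of_bound (C := ‖f‖) ?_ ?_
    · exact ((S.pk_measurable_bcf f).comp measurable_swap).aestronglyMeasurable
    · exact ae_of_all _ fun q => abs_integral_le (S.pk (q.2, q.1)) f

lemma Pf_Pf (S : MarkovFellerSemigroup X) {s u : ℝ} (hs : 0 ≤ s) (hu : 0 ≤ u) (f : X →ᵇ ℝ)
    (x : X) : S.Pf u (S.PB s f) x = S.Pf (u + s) f x := by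
  have := S.isProb u hu x
  simp only [Pf]
  rw [S.semigroup s u hs hu x, integral_bind_bcf _ _ (S.measurable_x s hs) (S.isProb s hs) f
    f.continuous.measurable ‖f‖ (fun x => f.norm_coe_le_norm x)]
  simp only [S.PB_apply hs, Pf]

lemma intervalIntegrable_Pf (S : MarkovFellerSemigroup X) (f : X →ᵇ ℝ) (x : X) {a b : ℝ}
    (ha : 0 ≤ a) (hb : 0 ≤ b) : IntervalIntegrable (fun s => S.Pf s f x) volume a b := by
  rw [intervalIntegrable_iff]
  have : IsFiniteMeasure (volume.restrict (uIoc a b)) := ⟨by simp [uIoc]⟩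
  refine Integrable.of_bound (C := ‖f‖) (S.measurable_t f x).aestronglyMeasurable ?_
  refine (ae_restrict_iff' measurableSet_uIoc).2 (ae_of_all _ fun s hs => ?_)
  refine S.abs_Pf_le ?_ x f
  have := hs.1
  have h2 : 0 ≤ min a b := le_min ha hb
  linarith

/-- approximate invariance -/
lemma Qf_PB (S : MarkovFellerSemigroup X) {s t : ℝ} (hs : 0 ≤ s) (ht : 0 < t) (f : X →ᵇ ℝ)
    (x : X) : |S.Qf t (S.PB s f) x - S.Qf t f x| ≤ 2 * s * ‖f‖ / t := by
  have h1 : S.Qf t (S.PB s f) x = (1 / t) * ∫ u in s..(t + s), S.Pf u f x := by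
    rw [Qf]
    congr 1
    have : ∫ u in (0:ℝ)..t, S.Pf u (S.PB s f) x = ∫ u in (0:ℝ)..t, S.Pf (u + s) f x := by
      refine intervalIntegral.integral_congr_ae (ae_of_all _ fun u hu => ?_)
      rw [uIoc_of_le ht.le] at hu
      exact S.Pf_Pf hs hu.1.le f x
    rw [this, intervalIntegral.integral_comp_add_right (fun u => S.Pf u f x)]
    simp
  have h2 : ∫ u in s..(t + s), S.Pf u f x = (∫ u in (0:ℝ)..t, S.Pf u f x)
      + (∫ u in t..(t + s), S.Pf u f x) - ∫ u in (0:ℝ)..s, S.Pf u f x := by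
    have hts : 0 ≤ t + s := by linarith
    have a1 := intervalIntegral.integral_add_adjacent_intervals
      (S.intervalIntegrable_Pf f x le_rfl hs) (S.intervalIntegrable_Pf f x hs hts)
    have a2 := intervalIntegral.integral_add_adjacent_intervals
      (S.intervalIntegrable_Pf f x le_rfl ht.le) (S.intervalIntegrable_Pf f x ht.le hts)
    linarith
  have b1 : |∫ u in t..(t + s), S.Pf u f x| ≤ ‖f‖ * s := by
    have := intervalIntegral.norm_integral_le_of_norm_le_const (a := t) (b := t + s)
      (f := fun u => S.Pf u f x) (C := ‖f‖) (fun u hu => by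
        rw [uIoc_of_le (by linarith)] at hu
        exact S.abs_Pf_le (by linarith [hu.1]) x f)
    simpa [abs_of_nonneg hs] using this
  have b2 : |∫ u in (0:ℝ)..s, S.Pf u f x| ≤ ‖f‖ * s := by
    have := intervalIntegral.norm_integral_le_of_norm_le_const (a := 0) (b := s)
      (f := fun u => S.Pf u f x) (C := ‖f‖) (fun u hu => by
        rw [uIoc_of_le hs] at hu
        exact S.abs_Pf_le (by linarith [hu.1]) x f)
    simpa [abs_of_nonneg hs] using this
  rw [h1, h2, Qf]
  rw [show ∀ a b c : ℝ, 1 / t * (a + b - c) - 1 / t * a = (b - c) / t from fun a b c => by ring,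
    abs_div, abs_of_pos ht]
  gcongr
  have := abs_sub (∫ u in t..(t + s), S.Pf u f x) (∫ u in (0:ℝ)..s, S.Pf u f x)
  linarith

lemma Qf_QB (S : MarkovFellerSemigroup X) {s t : ℝ} (hs : 0 < s) (ht : 0 < t) (f : X →ᵇ ℝ)
    (x : X) : |S.Qf t (S.QB s hs f) x - S.Qf t f x| ≤ 2 * s * ‖f‖ / t := by
  have := S.Qm_prob ht x
  have := unif_prob hs
  have h1 : S.Qf t (S.QB s hs f) x = ∫ u, (S.Qf t (S.PB u f) x) ∂(unif s) := by
    rw [← S.integral_Qm_bcf ht]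
    simp only [S.QB_apply hs]
    rw [S.integral_Qf hs, integral_unif hs, QfM]
    congr 1
    refine intervalIntegral.integral_congr_ae (ae_of_all _ fun u hu => ?_)
    rw [uIoc_of_le hs.le] at hu
    simp only [← S.integral_Qm_bcf ht, S.PB_apply hu.1.le]
  have hi : Integrable (fun u => S.Qf t (S.PB u f) x) (unif s) := by
    refine Integrable.of_bound (C := ‖f‖) ?_ ?_
    · have : (fun u => S.Qf t (S.PB u f) x) = fun u => ∫ y, S.PB u f y ∂(S.Qm t x) := by
        funext u; rw [S.integral_Qm_bcf ht]
      rw [this]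
      exact ((S.pk_measurable_bcf f).stronglyMeasurable.integral_prod_right'
        (ν := S.Qm t x)).aestronglyMeasurable
    · refine ae_of_all _ fun u => ?_
      refine (S.abs_Qf_le ht x _).trans ?_
      exact (norm_le (norm_nonneg f)).2 fun y => abs_integral_le (S.pk (u, y)) f
  have h2 : S.Qf t (S.QB s hs f) x - S.Qf t f x
      = ∫ u, (S.Qf t (S.PB u f) x - S.Qf t f x) ∂(unif s) := by
    rw [integral_sub hi (integrable_const _), h1]; simp
  rw [h2]
  have := norm_integral_le_of_norm_le_const (μ := unif s)
    (f := fun u => S.Qf t (S.PB u f) x - S.Qf t f x) (C := 2 * s * ‖f‖ / t) (by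
      unfold unif
      refine Measure.ae_smul_measure ?_ _
      refine (ae_restrict_iff' measurableSet_Ioc).2 (ae_of_all _ fun u hu => ?_)
      refine (S.Qf_PB hu.1.le ht f x).trans ?_
      gcongr
      exact hu.2)
  simpa using this

end Helpers

end MarkovFellerSemigroup

namespace MarkovFellerSemigroup

open ProbabilityTheory BoundedContinuousFunction

section Helpers

variable {X : Type*} [MetricSpace X] [CompleteSpace X]
  [TopologicalSpace.SeparableSpace X] [MeasurableSpace X] [BorelSpace X]

lemma ec_ev (S : MarkovFellerSemigroup X) {x : X} (h : S.CesaroEvContAt x) (f : X →ᵇ ℝ)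
    (hf : ∃ K, LipschitzWith K f) {η : ℝ} (hη : 0 < η) :
    ∀ᶠ y in 𝓝 x, ∀ᶠ t in atTop, |S.Qf t f y - S.Qf t f x| < η := by
  have h0 := h f ⟨hf, ‖f‖, fun x => f.norm_coe_le_norm x⟩
  have hb : ∀ y, ∀ᶠ t in atTop, |S.Qf t f y - S.Qf t f x| ≤ 2 * ‖f‖ := by
    intro y
    filter_upwards [eventually_gt_atTop 0] with t ht
    have h1 := abs_le.1 (S.abs_Qf_le ht y f)
    have h2 := abs_le.1 (S.abs_Qf_le ht x f)
    rw [abs_le]; constructor <;> linarith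
  have hc : ∀ y, IsCoboundedUnder (· ≤ ·) atTop (fun t => |S.Qf t f y - S.Qf t f x|) := by
    intro y
    exact isCoboundedUnder_le_of_le atTop (x := 0) (fun t => abs_nonneg _)
  have hl : ∀ y, limsup (fun t => |S.Qf t f y - S.Qf t f x|) atTop ≤ 2 * ‖f‖ :=
    fun y => limsup_le_of_le (hc y) (hb y)
  have h1 : ∀ᶠ y in 𝓝 x, limsup (fun t => |S.Qf t f y - S.Qf t f x|) atTop < η :=
    eventually_lt_of_limsup_lt (by rw [h0]; exact hη) (isBoundedUnder_of ⟨2 * ‖f‖, hl⟩)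
  filter_upwards [h1] with y hy
  exact eventually_lt_of_limsup_lt hy ⟨2 * ‖f‖, by simpa using hb y⟩

lemma exists_conv_subseq (S : MarkovFellerSemigroup X) (h : ∀ x, S.CesaroEvContAt x)
    {ι : Type*} [Countable ι] [Nonempty X]
    (f : ι → X →ᵇ ℝ) (hf : ∀ k, ∃ K, LipschitzWith K (f k)) (τ : ℕ → ℝ)
    (hτ : Tendsto τ atTop atTop) :
    ∃ φ : ℕ → ℕ, StrictMono φ ∧ ∃ L : ι → X → ℝ, (∀ k, Continuous (L k)) ∧
      ∀ k x, Tendsto (fun n => S.Qf (τ (φ n)) (f k) x) atTop (𝓝 (L k x)) := by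
  let d := TopologicalSpace.denseSeq X
  have hd : DenseRange d := TopologicalSpace.denseRange_denseSeq X
  let K : Set (ι × ℕ → ℝ) := pi univ (fun q => Icc (-‖f q.1‖) ‖f q.1‖)
  have hK : IsCompact K := isCompact_univ_pi fun q => isCompact_Icc
  have hev : ∃ᶠ n in atTop, (fun q : ι × ℕ => S.Qf (τ n) (f q.1) (d q.2)) ∈ K := by
    refine Eventually.frequently ?_
    filter_upwards [hτ.eventually (eventually_gt_atTop 0)] with n hn
    intro q _
    exact abs_le.1 (S.abs_Qf_le hn _ _)
  obtain ⟨a, -, φ, hφ, hlim⟩ := hK.tendsto_subseq' hev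
  have hτφ : Tendsto (fun n => τ (φ n)) atTop atTop := hτ.comp hφ.tendsto_atTop
  rw [tendsto_pi_nhds] at hlim
  have hC : ∀ k x, ∃ l, Tendsto (fun n => S.Qf (τ (φ n)) (f k) x) atTop (𝓝 l) := by
    intro k x
    apply cauchySeq_tendsto_of_complete
    rw [Metric.cauchySeq_iff']
    intro ε hε
    have h1 := S.ec_ev (h x) (f k) (hf k) (show 0 < ε / 4 by linarith)
    obtain ⟨U, hU, hUo, hxU⟩ := _root_.eventually_nhds_iff.1 h1
    obtain ⟨j, hj⟩ := hd.exists_mem_open hUo ⟨x, hxU⟩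
    have h2 := hτφ.eventually (hU _ hj)
    have h3 : CauchySeq (fun n => S.Qf (τ (φ n)) (f k) (d j)) := (hlim (k, j)).cauchySeq
    rw [Metric.cauchySeq_iff] at h3
    obtain ⟨N, hN⟩ := h3 (ε / 4) (by linarith)
    obtain ⟨N', hN'⟩ := eventually_atTop.1 h2
    refine ⟨max N N', fun n hn => ?_⟩
    have e1 := abs_lt.1 (hN' n (le_trans (le_max_right _ _) hn))
    have e2 := abs_lt.1 (hN' (max N N') (le_max_right _ _))
    have e3 := hN n (le_trans (le_max_left _ _) hn) (max N N') (le_max_left _ _)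
    rw [Real.dist_eq, abs_lt] at e3 ⊢
    constructor <;> linarith [e1.1, e1.2, e2.1, e2.2, e3.1, e3.2]
  choose L hL using hC
  refine ⟨φ, hφ, L, fun k => ?_, hL⟩
  rw [continuous_iff_continuousAt]
  intro x
  rw [ContinuousAt, Metric.tendsto_nhds]
  intro ε hε
  filter_upwards [S.ec_ev (h x) (f k) (hf k) (show 0 < ε / 2 by linarith)] with y hy
  have h1 : Tendsto (fun n => |S.Qf (τ (φ n)) (f k) y - S.Qf (τ (φ n)) (f k) x|) atTop
      (𝓝 |L k y - L k x|) := ((hL k y).sub (hL k x)).abs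
  have h2 := le_of_tendsto h1 ((hτφ.eventually hy).mono fun n hn => hn.le)
  rw [Real.dist_eq]; linarith

/-- Weak limits of Cesàro averages are invariant. -/
lemma invariant_of_tendsto (S : MarkovFellerSemigroup X) (x : X) (τ : ℕ → ℝ)
    (hτ : Tendsto τ atTop atTop) (μ : Measure X) [IsProbabilityMeasure μ]
    (hμ : ∀ f : X →ᵇ ℝ, Tendsto (fun n => S.Qf (τ n) f x) atTop (𝓝 (∫ y, f y ∂μ))) :
    S.Invariant μ := by
  refine ⟨inferInstance, fun s hs => ?_⟩
  have hm := S.measurable_x s hs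
  have : IsProbabilityMeasure (S.Pmeas s μ) := by
    constructor
    rw [Pmeas, Measure.bind_apply MeasurableSet.univ hm.aemeasurable]
    have : ∀ a, S.P s a univ = 1 := fun a => (S.isProb s hs a).measure_univ
    simp [this]
  refine ext_of_forall_integral_eq_of_IsFiniteMeasure fun f => ?_
  have e1 : ∫ y, f y ∂(S.Pmeas s μ) = ∫ y, S.PB s f y ∂μ := by
    rw [Pmeas, integral_bind_bcf _ _ hm (S.isProb s hs) f f.continuous.measurable ‖f‖
      (fun x => f.norm_coe_le_norm x)]
    simp only [S.PB_apply hs, Pf]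
  rw [e1]
  have h1 := hμ (S.PB s f)
  have h2 := hμ f
  have h3 : Tendsto (fun n => S.Qf (τ n) (S.PB s f) x - S.Qf (τ n) f x) atTop (𝓝 0) := by
    have h4 : Tendsto (fun n => 2 * s * ‖f‖ / τ n) atTop (𝓝 0) := hτ.const_div_atTop _
    refine squeeze_zero_norm' ?_ h4
    filter_upwards [hτ.eventually (eventually_gt_atTop 0)] with n hn
    exact S.Qf_PB hs hn f x
  have h5 := tendsto_nhds_unique h3 (h1.sub h2)
  linarith

lemma invariant_integral_PB (S : MarkovFellerSemigroup X) {μ : Measure X} (hμ : S.Invariant μ)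
    {s : ℝ} (hs : 0 ≤ s) (f : X →ᵇ ℝ) : ∫ y, S.PB s f y ∂μ = ∫ y, f y ∂μ := by
  have := hμ.1
  have hm := S.measurable_x s hs
  conv_rhs => rw [← hμ.2 s hs]
  rw [Pmeas, integral_bind_bcf _ _ hm (S.isProb s hs) f f.continuous.measurable ‖f‖
      (fun x => f.norm_coe_le_norm x)]
  simp only [S.PB_apply hs, Pf]

lemma invariant_integral_Qf (S : MarkovFellerSemigroup X) {μ : Measure X} (hμ : S.Invariant μ)
    {t : ℝ} (ht : 0 < t) (f : X →ᵇ ℝ) : ∫ y, S.Qf t f y ∂μ = ∫ y, f y ∂μ := by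
  have := hμ.1
  rw [S.integral_Qf ht f μ, QfM]
  have : ∫ s in (0:ℝ)..t, ∫ x, S.Pf s f x ∂μ = ∫ s in (0:ℝ)..t, ∫ y, f y ∂μ := by
    refine intervalIntegral.integral_congr fun s hs => ?_
    rw [uIcc_of_le ht.le] at hs
    simp only [← S.PB_apply hs.1]
    exact S.invariant_integral_PB hμ hs.1 f
  rw [this]
  simp; field_simp

/-- Prokhorov: tight sequences of Cesàro averages subconverge to an invariant measure. -/
lemma exists_invariant_of_tight (S : MarkovFellerSemigroup X) (x : X) (τ : ℕ → ℝ)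
    (hpos : ∀ n, 0 < τ n)
    (hτ : Tendsto τ atTop atTop)
    (ht : ∀ ε > (0:ℝ), ∃ K : Set X, IsCompact K ∧ ∀ n, 1 - ε ≤ (S.Qm (τ n) x).real K) :
    ∃ φ : ℕ → ℕ, StrictMono φ ∧ ∃ μ : Measure X, S.Invariant μ ∧
      ∀ f : X →ᵇ ℝ, Tendsto (fun n => S.Qf (τ (φ n)) f x) atTop (𝓝 (∫ y, f y ∂μ)) := by
  let p : ℕ → ProbabilityMeasure X := fun n => ⟨S.Qm (τ n) x, S.Qm_prob (hpos n) x⟩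
  have hT : IsTightMeasureSet {((μ : ProbabilityMeasure X) : Measure X) | μ ∈ range p} := by
    rw [isTightMeasureSet_iff_exists_isCompact_measure_compl_le]
    intro ε hε
    by_cases hεt : ε = ⊤
    · exact ⟨∅, isCompact_empty, by simp [hεt]⟩
    obtain ⟨K, hK, hKn⟩ := ht ε.toReal (ENNReal.toReal_pos hε.ne' hεt)
    refine ⟨K, hK, ?_⟩
    rintro _ ⟨_, ⟨n, rfl⟩, rfl⟩
    have := S.Qm_prob (hpos n) x
    have h1 := hKn n
    have h2 := probReal_compl_eq_one_sub (μ := S.Qm (τ n) x) hK.measurableSet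
    have h3 : (S.Qm (τ n) x).real Kᶜ ≤ ε.toReal := by linarith
    rw [Measure.real, ENNReal.toReal_le_toReal (measure_ne_top _ _) hεt] at h3
    exact h3
  have hcpt := isCompact_closure_of_isTightMeasureSet hT
  obtain ⟨μ, -, φ, hφ, hlim⟩ := hcpt.tendsto_subseq (x := p)
    (fun n => subset_closure ⟨n, rfl⟩)
  rw [ProbabilityMeasure.tendsto_iff_forall_integral_tendsto] at hlim
  have hl : ∀ f : X →ᵇ ℝ, Tendsto (fun n => S.Qf (τ (φ n)) f x) atTop
      (𝓝 (∫ y, f y ∂(μ : Measure X))) := by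
    intro f
    refine (hlim f).congr fun n => ?_
    exact S.integral_Qm_bcf (hpos _) x f
  exact ⟨φ, hφ, μ, S.invariant_of_tendsto x _ (hτ.comp hφ.tendsto_atTop) _ hl, hl⟩

end Helpers

end MarkovFellerSemigroup

namespace MarkovFellerSemigroup

open ProbabilityTheory BoundedContinuousFunction

section Helpers

variable {X : Type*} [MetricSpace X] [CompleteSpace X]
  [TopologicalSpace.SeparableSpace X] [MeasurableSpace X] [BorelSpace X]

lemma Qm_null (S : MarkovFellerSemigroup X) {t n : ℝ} (htn : t ≤ n) (hn : 0 < n) (x : X)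
    {A : Set X} (hA : MeasurableSet A) (h : S.Qm n x A = 0) : S.Qm t x A = 0 := by
  have hm : Measurable fun s => S.pk (s, x) A :=
    (Measure.measurable_coe hA).comp (S.pk_measurable_left x)
  rw [Qm, Measure.bind_apply hA (S.pk_measurable_left x).aemeasurable,
    lintegral_eq_zero_iff hm] at h ⊢
  have hac : unif t ≪ unif n := by
    unfold unif
    refine (Measure.smul_absolutelyContinuous).trans ?_
    refine (Measure.absolutelyContinuous_of_le
      (Measure.restrict_mono (Ioc_subset_Ioc_right htn) le_rfl)).trans ?_
    exact Measure.absolutelyContinuous_smul (ENNReal.inv_ne_zero.2 ENNReal.ofReal_ne_top)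
  exact hac.ae_le h

lemma exists_nat_hit (S : MarkovFellerSemigroup X) {z x : X} {ε : ℝ}
    (hlow : 0 < limsup (fun t => S.Qmeas t x (ball z ε)) atTop) :
    ∃ n : ℕ, S.Qm ((n : ℝ) + 1) x (ball z ε) ≠ 0 := by
  by_contra! hcon
  have h1 : ∀ᶠ t in atTop, S.Qmeas t x (ball z ε) = 0 := by
    filter_upwards [eventually_gt_atTop 0] with t ht
    obtain ⟨n, hn⟩ := exists_nat_gt t
    rw [← S.Qm_real ht x measurableSet_ball, Measure.real,
      S.Qm_null (n := (n:ℝ)+1) (by linarith) (by positivity) x measurableSet_ball (hcon n)]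
    simp
  have h2 : limsup (fun t => S.Qmeas t x (ball z ε)) atTop = 0 := by
    rw [limsup_congr h1]; simp
  linarith

lemma Pf_QB (S : MarkovFellerSemigroup X) {s t : ℝ} (hs : 0 ≤ s) (ht : 0 < t) (f : X →ᵇ ℝ)
    (x : X) : ∫ y, S.Qf t f y ∂(S.P s x) = S.Qf t (S.PB s f) x := by
  have := S.isProb s hs x
  rw [S.integral_Qf ht f, QfM, Qf]
  congr 1
  refine intervalIntegral.integral_congr fun u hu => ?_
  rw [uIcc_of_le ht.le] at hu
  change ∫ y, S.Pf u f y ∂(S.P s x) = S.Pf u (S.PB s f) x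
  rw [S.Pf_Pf hs hu.1, add_comm, ← S.Pf_Pf hu.1 hs, Pf]
  simp only [S.PB_apply hu.1]

/-- the key rigidity statement -/
lemma integral_eq_of_lim (S : MarkovFellerSemigroup X) (z : X)
    (hlow : ∀ x : X, ∀ ε > (0:ℝ), 0 < limsup (fun t => S.Qmeas t x (ball z ε)) atTop)
    (f : X →ᵇ ℝ) (τ : ℕ → ℝ) (hpos : ∀ n, 0 < τ n) (hτ : Tendsto τ atTop atTop)
    (L : X → ℝ) (hLc : Continuous L)
    (hL : ∀ x, Tendsto (fun n => S.Qf (τ n) f x) atTop (𝓝 (L x)))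
    {μ : Measure X} (hμ : S.Invariant μ) : ∫ y, f y ∂μ = L z := by
  have := hμ.1
  have hLb : ∀ x, ‖L x‖ ≤ ‖f‖ := fun x =>
    le_of_tendsto (hL x).norm (Eventually.of_forall fun n => S.abs_Qf_le (hpos n) x f)
  let H : X →ᵇ ℝ := BoundedContinuousFunction.ofNormedAddCommGroup L hLc ‖f‖ hLb
  have hH : ∀ x, H x = L x := fun x => rfl
  have hdct : ∀ ν : Measure X, IsProbabilityMeasure ν →
      Tendsto (fun n => ∫ y, S.Qf (τ n) f y ∂ν) atTop (𝓝 (∫ y, L y ∂ν)) := by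
    intro ν hν
    refine tendsto_integral_of_dominated_convergence (fun _ => ‖f‖) ?_ ?_ ?_ ?_
    · intro n; exact (S.continuous_Qf (hpos n) f).aestronglyMeasurable
    · exact integrable_const _
    · intro n; exact ae_of_all _ fun y => S.abs_Qf_le (hpos n) y f
    · exact ae_of_all _ hL
  have hinv : ∀ s, 0 ≤ s → ∀ x, S.Pf s H x = L x := by
    intro s hs x
    have h1 := hdct (S.P s x) (S.isProb s hs x)
    simp_rw [fun n => S.Pf_QB hs (hpos n) f x] at h1
    have h3 : Tendsto (fun n => S.Qf (τ n) (S.PB s f) x - S.Qf (τ n) f x) atTop (𝓝 0) := by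
      have h4 : Tendsto (fun n => 2 * s * ‖f‖ / τ n) atTop (𝓝 0) := hτ.const_div_atTop _
      refine squeeze_zero_norm' ?_ h4
      filter_upwards [] with n
      exact S.Qf_PB hs (hpos n) f x
    have h5 := tendsto_nhds_unique h3 (h1.sub (hL x))
    have h6 : S.Pf s H x = ∫ y, L y ∂(S.P s x) := rfl
    linarith
  have hQ : ∀ t, 0 < t → ∀ x, S.Qf t H x = L x := by
    intro t ht x
    rw [Qf]
    have : ∫ s in (0:ℝ)..t, S.Pf s H x = ∫ s in (0:ℝ)..t, L x := by
      refine intervalIntegral.integral_congr fun s hs => ?_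
      rw [uIcc_of_le ht.le] at hs
      exact hinv s hs.1 x
    rw [this]; simp; field_simp
  have hvar : ∀ t, 0 < t → ∀ x, ∫ y, (L y - L x) ^ 2 ∂(S.Qm t x)
      = S.Qf t (H * H : X →ᵇ ℝ) x - L x ^ 2 := by
    intro t ht x
    have := S.Qm_prob ht x
    have e1 : (fun y => (L y - L x) ^ 2) = fun y => ((H * H : X →ᵇ ℝ) y - (2 * L x) * H y)
        + L x ^ 2 := by
      funext y
      change _ = (L y * L y - _ * L y) + _
      ring
    have i1 := (H * H).integrable (S.Qm t x)
    have i2 : Integrable (fun y => (2 * L x) * H y) (S.Qm t x) := (H.integrable _).const_mul _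
    have i3 : Integrable (fun y => (H * H : X →ᵇ ℝ) y - (2 * L x) * H y) (S.Qm t x) := i1.sub i2
    rw [e1, integral_add i3 (integrable_const _), integral_sub i1 i2,
      integral_const_mul, S.integral_Qm_bcf ht, S.integral_Qm_bcf ht, hQ t ht]
    simp
    ring
  have hae : ∀ᵐ x ∂μ, ∀ n : ℕ, ∀ᵐ y ∂(S.Qm ((n:ℝ)+1) x), L y = L x := by
    rw [ae_all_iff]
    intro n
    have hn : (0:ℝ) < (n:ℝ) + 1 := by positivity
    have i1 : Integrable (fun x => S.Qf ((n:ℝ)+1) (H * H : X →ᵇ ℝ) x) μ := by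
      have := (S.QB _ hn (H * H)).integrable μ
      refine this.congr (ae_of_all _ fun x => S.QB_apply hn _ x)
    have i2 : Integrable (fun x => L x ^ 2) μ := by
      refine ((H * H).integrable μ).congr (ae_of_all _ fun x => ?_)
      change L x * L x = _
      ring
    have h0 : ∫ x, (S.Qf ((n:ℝ)+1) (H * H : X →ᵇ ℝ) x - L x ^ 2) ∂μ = 0 := by
      rw [integral_sub i1 i2, S.invariant_integral_Qf hμ hn, sub_eq_zero]
      refine integral_congr_ae (ae_of_all _ fun x => ?_)
      change L x * L x = _
      ring
    rw [integral_eq_zero_iff_of_nonneg] at h0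
    · filter_upwards [h0] with x hx
      have h1 := hvar _ hn x
      have hx' : S.Qf ((n:ℝ)+1) (H * H : X →ᵇ ℝ) x - L x ^ 2 = 0 := hx
      rw [hx', integral_eq_zero_iff_of_nonneg (fun y => by positivity)] at h1
      · filter_upwards [h1] with y hy
        have : (L y - L x) ^ 2 = 0 := hy
        have := pow_eq_zero_iff (two_ne_zero) |>.1 this
        linarith
      · have := S.Qm_prob hn x
        refine Integrable.of_bound (C := (‖f‖ + ‖f‖) ^ 2)
          ((hLc.sub continuous_const).pow 2).aestronglyMeasurable (ae_of_all _ fun y => ?_)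
        rw [norm_pow]
        gcongr
        exact (norm_sub_le _ _).trans (add_le_add (hLb _) (hLb _))
    · intro x
      change 0 ≤ S.Qf ((n:ℝ)+1) (H * H : X →ᵇ ℝ) x - L x ^ 2
      rw [← hvar _ hn x]
      positivity
    · exact i1.sub i2
  have hconst : ∀ᵐ x ∂μ, L x = L z := by
    filter_upwards [hae] with x hx
    by_contra hne
    have h1 : ∀ᶠ y in 𝓝 z, L y ≠ L x :=
      hLc.continuousAt.eventually_ne (Ne.symm hne)
    obtain ⟨ε, hε, hb⟩ := Metric.eventually_nhds_iff_ball.1 h1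
    obtain ⟨n, hn⟩ := S.exists_nat_hit (hlow x ε hε)
    apply hn
    exact measure_mono_null (fun y hy => hb y hy) (ae_iff.1 (hx n))
  have e1 := hdct μ inferInstance
  simp_rw [fun n => S.invariant_integral_Qf hμ (hpos n) f] at e1
  have e2 := tendsto_nhds_unique tendsto_const_nhds e1
  rw [e2, integral_congr_ae hconst]
  simp

lemma tendsto_natCast_succ : Tendsto (fun n : ℕ => (n:ℝ) + 1) atTop atTop :=
  tendsto_atTop_add_const_right _ _ tendsto_natCast_atTop_atTop

lemma invariant_unique (S : MarkovFellerSemigroup X) (h : ∀ x, S.CesaroEvContAt x) (z : X)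
    (hlow : ∀ x : X, ∀ ε > (0:ℝ), 0 < limsup (fun t => S.Qmeas t x (ball z ε)) atTop)
    {μ ν : Measure X} (hμ : S.Invariant μ) (hν : S.Invariant ν) : ν = μ := by
  have : Nonempty X := ⟨z⟩
  let μ' : ProbabilityMeasure X := ⟨μ, hμ.1⟩
  let ν' : ProbabilityMeasure X := ⟨ν, hν.1⟩
  have hT : Tendsto (fun _ : ℕ => ν') atTop (𝓝 μ') := by
    rw [tendsto_iff_forall_lipschitz_integral_tendsto]
    rintro f ⟨C, hC⟩ ⟨K, hK⟩
    let g : X →ᵇ ℝ := ⟨⟨f, hK.continuous⟩, ⟨C, hC⟩⟩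
    obtain ⟨φ, hφ, L, hLc, hL⟩ := S.exists_conv_subseq h (fun _ : Unit => g) (fun _ => ⟨K, hK⟩)
      (fun n : ℕ => (n:ℝ) + 1) tendsto_natCast_succ
    have e : ∀ m : Measure X, S.Invariant m → ∫ y, g y ∂m = L () z := fun m hm =>
      S.integral_eq_of_lim z hlow g (fun n => (φ n : ℝ) + 1) (fun n => by positivity)
        (tendsto_natCast_succ.comp hφ.tendsto_atTop) (L ()) (hLc ()) (hL ()) hm
    have e3 : ∫ y, f y ∂ν = ∫ y, f y ∂μ := (e ν hν).trans (e μ hμ).symm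
    change Tendsto (fun _ : ℕ => ∫ y, f y ∂ν) atTop (𝓝 (∫ y, f y ∂μ))
    rw [e3]; exact tendsto_const_nhds
  have := tendsto_nhds_unique tendsto_const_nhds hT
  exact congrArg Subtype.val this

lemma mem_msupp (S : MarkovFellerSemigroup X) (z : X)
    (hlow : ∀ x : X, ∀ ε > (0:ℝ), 0 < limsup (fun t => S.Qmeas t x (ball z ε)) atTop)
    {μ : Measure X} (hμ : S.Invariant μ) : z ∈ msupp μ := by
  intro ε hε
  by_contra hcon
  have hz : μ (ball z ε) = 0 := by simpa using hcon
  have := hμ.1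
  let g : X →ᵇ ℝ := BoundedContinuousFunction.ofNormedAddCommGroup
    (fun y => max 0 (ε - dist y z)) (by fun_prop) ε (fun y => by
      rw [Real.norm_of_nonneg (le_max_left _ _)]
      exact max_le hε.le (by linarith [dist_nonneg (x := y) (y := z)]))
  have hg : ∀ y, g y = max 0 (ε - dist y z) := fun y => rfl
  have hg0 : ∀ y, 0 ≤ g y := fun y => le_max_left _ _
  have h0 : ∫ y, g y ∂μ = 0 := by
    refine integral_eq_zero_of_ae ?_
    have : ∀ᵐ y ∂μ, y ∉ ball z ε := measure_eq_zero_iff_ae_notMem.1 hz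
    filter_upwards [this] with y hy
    rw [hg]
    simp only [mem_ball, not_lt] at hy
    exact max_eq_left (by linarith)
  have hae : ∀ᵐ x ∂μ, ∀ n : ℕ, S.Qm ((n:ℝ)+1) x (ball z ε) = 0 := by
    rw [ae_all_iff]
    intro n
    have hn : (0:ℝ) < (n:ℝ) + 1 := by positivity
    have h1 := S.invariant_integral_Qf hμ hn g
    rw [h0, integral_eq_zero_iff_of_nonneg] at h1
    · filter_upwards [h1] with x hx
      have hx' : S.Qf ((n:ℝ)+1) g x = 0 := hx
      have := S.Qm_prob hn x
      rw [← S.integral_Qm_bcf hn, integral_eq_zero_iff_of_nonneg hg0 (g.integrable _)] at hx'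
      refine measure_mono_null (fun y hy => ?_) (ae_iff.1 hx')
      change ¬ (g y = 0)
      rw [hg]
      have : 0 < ε - dist y z := by simpa using hy
      exact (lt_max_of_lt_right this).ne'
    · intro x
      have := S.Qm_prob hn x
      change 0 ≤ S.Qf _ _ _
      rw [← S.integral_Qm_bcf hn]
      exact integral_nonneg hg0
    · have := (S.QB _ hn g).integrable μ
      refine this.congr (ae_of_all _ fun x => S.QB_apply hn _ x)
  obtain ⟨x, hx⟩ := hae.exists
  obtain ⟨n, hn⟩ := S.exists_nat_hit (hlow x ε hε)
  exact hn (hx n)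

lemma measure_compl_msupp (ν : Measure X) : ν (msupp ν)ᶜ = 0 := by
  have : SecondCountableTopology X := UniformSpace.secondCountable_of_separable X
  refine measure_null_of_locally_null _ fun x hx => ?_
  have : ∃ ε > (0:ℝ), ν (ball x ε) = 0 := by
    by_contra! hc
    exact hx fun ε hε => pos_iff_ne_zero.2 (hc ε hε)
  obtain ⟨ε, hε, h0⟩ := this
  exact ⟨ball x ε, mem_nhdsWithin_of_mem_nhds (ball_mem_nhds x hε), h0⟩

lemma conv_of_Tset (S : MarkovFellerSemigroup X) {μ : Measure X}
    (huniq : ∀ ν, S.Invariant ν → ν = μ) {x : X} (hx : x ∈ S.Tset) : S.QWeakLim x μ := by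
  intro f
  refine tendsto_of_subseq_tendsto fun ns hns => ?_
  have hτ : Tendsto (fun n => max (ns n) 1) atTop atTop :=
    tendsto_atTop_mono (fun n => le_max_left _ _) hns
  obtain ⟨φ, hφ, ν, hν, hl⟩ := S.exists_invariant_of_tight x (fun n => max (ns n) 1)
    (fun n => lt_of_lt_of_le one_pos (le_max_right _ _)) hτ (fun ε hε => by
      obtain ⟨K, hK, hKt⟩ := hx ε hε
      refine ⟨K, hK, fun n => ?_⟩
      have hp : 0 < max (ns n) 1 := lt_of_lt_of_le one_pos (le_max_right _ _)
      rw [S.Qm_real hp x hK.measurableSet]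
      exact hKt _ hp)
  refine ⟨φ, ?_⟩
  rw [← huniq ν hν]
  refine (hl f).congr' ?_
  filter_upwards [(hns.comp hφ.tendsto_atTop).eventually (eventually_ge_atTop 1)] with n hn
  have : max (ns (φ n)) 1 = ns (φ n) := max_eq_left hn
  simp only [this]

lemma conv_measure (S : MarkovFellerSemigroup X) {μ : Measure X}
    (huniq : ∀ ν, S.Invariant ν → ν = μ) (hμ : S.Invariant μ) (ν : Measure X)
    (hν : IsProbabilityMeasure ν) (hs : msupp ν ⊆ S.Tset) : S.QWeakLimM ν μ := by
  intro f
  have h1 : ∀ᵐ x ∂ν, Tendsto (fun t => S.Qf t f x) atTop (𝓝 (∫ y, f y ∂μ)) := by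
    have : ∀ᵐ x ∂ν, x ∈ msupp ν := measure_compl_msupp ν
    filter_upwards [this] with x hx
    exact S.conv_of_Tset huniq (hs hx) f
  have h2 : Tendsto (fun t => ∫ x, S.Qf t f x ∂ν) atTop (𝓝 (∫ _, (∫ y, f y ∂μ) ∂ν)) := by
    refine tendsto_integral_filter_of_dominated_convergence (fun _ => ‖f‖) ?_ ?_ ?_ h1
    · filter_upwards [eventually_gt_atTop 0] with t ht
      exact (S.continuous_Qf ht f).aestronglyMeasurable
    · filter_upwards [eventually_gt_atTop 0] with t ht
      exact ae_of_all _ fun y => S.abs_Qf_le ht y f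
    · exact integrable_const _
  simp only [integral_const, probReal_univ, smul_eq_mul, one_mul] at h2
  refine h2.congr' ?_
  filter_upwards [eventually_gt_atTop 0] with t ht
  exact S.integral_Qf ht f ν

end Helpers

end MarkovFellerSemigroup

namespace MarkovFellerSemigroup

open ProbabilityTheory BoundedContinuousFunction

section Helpers

variable {X : Type*} [MetricSpace X] [CompleteSpace X]
  [TopologicalSpace.SeparableSpace X] [MeasurableSpace X] [BorelSpace X]

/-- Lipschitz bump function. -/
noncomputable def bmp {δ : ℝ} (hδ : 0 < δ) (E : Set X) : X →ᵇ ℝ :=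
  BoundedContinuousFunction.ofNormedAddCommGroup (fun y => ((thickenedIndicator hδ E y : NNReal) : ℝ))
    (NNReal.continuous_coe.comp (thickenedIndicator hδ E).continuous) 1 (fun y => by
      rw [NNReal.norm_eq]; exact_mod_cast thickenedIndicator_le_one hδ E y)

lemma bmp_apply {δ : ℝ} (hδ : 0 < δ) (E : Set X) (y : X) :
    bmp hδ E y = ((thickenedIndicator hδ E y : NNReal) : ℝ) := rfl

lemma bmp_nonneg {δ : ℝ} (hδ : 0 < δ) (E : Set X) (y : X) : 0 ≤ bmp hδ E y := by
  rw [bmp_apply]; positivity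

lemma bmp_le_one {δ : ℝ} (hδ : 0 < δ) (E : Set X) (y : X) : bmp hδ E y ≤ 1 := by
  rw [bmp_apply]; exact_mod_cast thickenedIndicator_le_one hδ E y

lemma bmp_one {δ : ℝ} (hδ : 0 < δ) {E : Set X} {y : X} (hy : y ∈ E) : bmp hδ E y = 1 := by
  rw [bmp_apply, thickenedIndicator_one hδ E hy]; simp

lemma bmp_zero {δ : ℝ} (hδ : 0 < δ) {E : Set X} {y : X} (hy : y ∉ thickening δ E) :
    bmp hδ E y = 0 := by
  rw [bmp_apply, thickenedIndicator_zero hδ E hy]; simp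

lemma bmp_mono {δ : ℝ} (hδ : 0 < δ) {E E' : Set X} (h : E ⊆ E') (y : X) :
    bmp hδ E y ≤ bmp hδ E' y := by
  rw [bmp_apply, bmp_apply]
  exact_mod_cast thickenedIndicator_subset hδ h y

lemma bmp_lip {δ : ℝ} (hδ : 0 < δ) (E : Set X) : ∃ K, LipschitzWith K (bmp hδ E) := by
  have := lipschitzWith_thickenedIndicator hδ E
  refine ⟨_, LipschitzWith.of_dist_le_mul (K := δ.toNNReal⁻¹) fun x y => ?_⟩
  have h := this.dist_le_mul x y
  rwa [NNReal.dist_eq, ← Real.dist_eq] at h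

lemma bmp_norm {δ : ℝ} (hδ : 0 < δ) (E : Set X) : ‖bmp hδ E‖ ≤ 1 := by
  rw [BoundedContinuousFunction.norm_le zero_le_one]
  intro y
  rw [Real.norm_of_nonneg (bmp_nonneg hδ E y)]
  exact bmp_le_one hδ E y

lemma bmp_union {δ : ℝ} (hδ : 0 < δ) (E E' : Set X) (y : X) :
    bmp hδ (E ∪ E') y ≤ bmp hδ E y + bmp hδ E' y := by
  have key : ∀ A A' : Set X, infEDist y A = infEDist y A' → bmp hδ A y = bmp hδ A' y := by
    intro A A' h
    rw [bmp_apply, bmp_apply]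
    simp [thickenedIndicator, thickenedIndicatorAux, h]
  rcases le_total (infEDist y E) (infEDist y E') with h | h
  · rw [key (E ∪ E') E (by rw [infEDist_union]; exact min_eq_left h)]
    linarith [bmp_nonneg hδ E' y]
  · rw [key (E ∪ E') E' (by rw [infEDist_union]; exact min_eq_right h)]
    linarith [bmp_nonneg hδ E y]

lemma measureReal_le_bmp {δ : ℝ} (hδ : 0 < δ) {E : Set X} (hE : MeasurableSet E) (μ : Measure X)
    [IsProbabilityMeasure μ] : μ.real E ≤ ∫ y, bmp hδ E y ∂μ := by
  rw [← integral_indicator_one hE]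
  refine integral_mono ((integrable_const (1:ℝ)).indicator hE) ((bmp hδ E).integrable _) fun y => ?_
  by_cases hy : y ∈ E
  · simp [hy, bmp_one hδ hy]
  · simp [hy, bmp_nonneg hδ E y]

lemma bmp_le_measureReal {δ : ℝ} (hδ : 0 < δ) {E A : Set X} (hA : MeasurableSet A)
    (h : thickening δ E ⊆ A) (μ : Measure X)
    [IsProbabilityMeasure μ] : ∫ y, bmp hδ E y ∂μ ≤ μ.real A := by
  rw [← integral_indicator_one hA]
  refine integral_mono ((bmp hδ E).integrable _) ((integrable_const (1:ℝ)).indicator hA) fun y => ?_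
  by_cases hy : y ∈ A
  · simp [hy, bmp_le_one hδ E y]
  · simp [hy, bmp_zero hδ (fun hh => hy (h hh))]

lemma mul_measureReal_le (μ : Measure X) [IsProbabilityMeasure μ] (g : X →ᵇ ℝ) (hg : ∀ y, 0 ≤ g y)
    {E : Set X} {c : ℝ} (hc : 0 ≤ c) (hE : ∀ y ∈ E, c ≤ g y) : c * μ.real E ≤ ∫ y, g y ∂μ := by
  refine le_trans ?_ (mul_meas_ge_le_integral_of_nonneg (ae_of_all _ hg) (g.integrable μ) c)
  exact mul_le_mul_of_nonneg_left (measureReal_mono hE) hc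

/-- Baire category theorem relative to an open piece of a closed set. -/
lemma baire_dense {C B : Set X} (hC : IsClosed C) (hB : IsOpen B) (hne : (B ∩ C).Nonempty)
    (O : ℕ → Set X) (hO : ∀ n, IsOpen (O n))
    (hd : ∀ n, ∀ U, IsOpen U → U ⊆ B → (U ∩ C).Nonempty → (U ∩ C ∩ O n).Nonempty) :
    ∃ x ∈ B ∩ C, ∀ n, x ∈ O n := by
  have : CompleteSpace C := hC.completeSpace_coe
  let B' : Set C := (↑) ⁻¹' B
  have hB' : IsOpen B' := hB.preimage continuous_subtype_val
  let O' : ℕ → Set C := fun n => (↑) ⁻¹' (O n) ∪ (closure B')ᶜ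
  have ho : ∀ n, IsOpen (O' n) := fun n =>
    ((hO n).preimage continuous_subtype_val).union isClosed_closure.isOpen_compl
  have hdn : ∀ n, Dense (O' n) := by
    intro n
    rw [dense_iff_inter_open]
    intro U hU hUne
    by_cases hm : (U ∩ B').Nonempty
    · obtain ⟨W, hW, hWU⟩ := isOpen_induced_iff.1 (hU.inter hB')
      obtain ⟨x, hx⟩ := hm
      have hxW : (x : X) ∈ W := by
        have : x ∈ (Subtype.val ⁻¹' W : Set C) := by rw [hWU]; exact hx
        exact this
      obtain ⟨y, ⟨⟨hyW, hyB⟩, hyC⟩, hyO⟩ := hd n (W ∩ B) (hW.inter hB) inter_subset_right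
        ⟨x, ⟨hxW, hx.2⟩, x.2⟩
      have : (⟨y, hyC⟩ : C) ∈ U ∩ B' := by rw [← hWU]; exact hyW
      exact ⟨⟨y, hyC⟩, this.1, Or.inl hyO⟩
    · obtain ⟨x, hx⟩ := hUne
      refine ⟨x, hx, Or.inr fun hcl => hm ?_⟩
      exact mem_closure_iff.1 hcl U hU hx
  obtain ⟨b, hbB, hbC⟩ := hne
  obtain ⟨x, hxB, hx⟩ := (dense_iInter_of_isOpen_nat ho hdn).inter_open_nonempty B' hB'
    ⟨⟨b, hbC⟩, hbB⟩
  refine ⟨x, ⟨hxB, x.2⟩, fun n => ?_⟩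
  rcases mem_iInter.1 hx n with h | h
  · exact h
  · exact absurd (subset_closure hxB) h

lemma baire_closed {C B : Set X} (hC : IsClosed C) (hB : IsOpen B) (hne : (B ∩ C).Nonempty)
    (E : ℕ → Set X) (hE : ∀ n, IsClosed (E n)) (hcov : ∀ x ∈ B ∩ C, ∃ n, x ∈ E n) :
    ∃ n, ∃ U, IsOpen U ∧ U ⊆ B ∧ (U ∩ C).Nonempty ∧ U ∩ C ⊆ E n := by
  by_contra! hcon
  obtain ⟨x, hx, hxn⟩ := baire_dense hC hB hne (fun n => (E n)ᶜ) (fun n => (hE n).isOpen_compl)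
    (fun n U hU hUB hUne => by
      obtain ⟨y, hy, hyE⟩ := not_subset.1 (hcon n U hU hUB hUne)
      exact ⟨y, hy, hyE⟩)
  obtain ⟨n, hn⟩ := hcov x hx
  exact hxn n hn

end Helpers

end MarkovFellerSemigroup

namespace MarkovFellerSemigroup

open ProbabilityTheory BoundedContinuousFunction

section Helpers

variable {X : Type*} [MetricSpace X] [CompleteSpace X]
  [TopologicalSpace.SeparableSpace X] [MeasurableSpace X] [BorelSpace X]

/-- Points accessible from `z`. -/
def acc (S : MarkovFellerSemigroup X) (z : X) : Set X :=
  {x | ∀ ε > (0:ℝ), ∃ s, 0 ≤ s ∧ S.P s z (ball x ε) ≠ 0}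

lemma acc_closed (S : MarkovFellerSemigroup X) (z : X) : IsClosed (S.acc z) := by
  refine isClosed_of_closure_subset fun x hx ε hε => ?_
  obtain ⟨y, hy, hd⟩ := Metric.mem_closure_iff.1 hx (ε / 2) (by linarith)
  obtain ⟨s, hs, h0⟩ := hy (ε / 2) (by linarith)
  refine ⟨s, hs, fun h => h0 (measure_mono_null (ball_subset_ball' ?_) h)⟩
  rw [dist_comm]; linarith

lemma self_mem_acc (S : MarkovFellerSemigroup X) (z : X) : z ∈ S.acc z := by
  intro ε hε
  refine ⟨0, le_rfl, ?_⟩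
  rw [S.id0]
  simp [hε]

lemma P_acc_compl (S : MarkovFellerSemigroup X) (z : X) {s : ℝ} (hs : 0 ≤ s) :
    S.P s z (S.acc z)ᶜ = 0 := by
  have : SecondCountableTopology X := UniformSpace.secondCountable_of_separable X
  refine measure_null_of_locally_null _ fun x hx => ?_
  have : ∃ ε > (0:ℝ), ∀ s, 0 ≤ s → S.P s z (ball x ε) = 0 := by
    by_contra! hc
    exact hx hc
  obtain ⟨ε, hε, h0⟩ := this
  exact ⟨ball x ε, mem_nhdsWithin_of_mem_nhds (ball_mem_nhds x hε), h0 s hs⟩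

lemma Qm_acc_compl (S : MarkovFellerSemigroup X) (z : X) (t : ℝ) :
    S.Qm t z (S.acc z)ᶜ = 0 := by
  rw [Qm, Measure.bind_apply (S.acc_closed z).measurableSet.compl
    (S.pk_measurable_left z).aemeasurable]
  have : ∀ s, S.pk (s, z) (S.acc z)ᶜ = 0 := fun s => S.P_acc_compl z (le_max_right _ _)
  simp [this]

lemma acc_rec (S : MarkovFellerSemigroup X) (z : X)
    (hlow : ∀ x : X, ∀ ε > (0:ℝ), 0 < limsup (fun t => S.Qmeas t x (ball z ε)) atTop)
    {V : Set X} (hV : IsOpen V) (hne : (V ∩ S.acc z).Nonempty) :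
    ∃ α > 0, ∃ᶠ T in atTop, α ≤ (S.Qm T z).real (V ∩ S.acc z) := by
  obtain ⟨x, hxV, hx⟩ := hne
  obtain ⟨ρ, hρ, hρV⟩ := Metric.isOpen_iff.1 hV x hxV
  have hρ2 : 0 < ρ / 2 := by linarith
  let φ : X →ᵇ ℝ := bmp hρ2 (ball x (ρ / 2))
  have hth : thickening (ρ / 2) (ball x (ρ / 2)) ⊆ V := by
    intro y hy
    obtain ⟨w, hw, hyw⟩ := mem_thickening_iff.1 hy
    apply hρV
    rw [mem_ball] at hw ⊢
    linarith [dist_triangle y w x]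
  obtain ⟨s, hs, h0⟩ := hx (ρ / 2) hρ2
  have hps := S.isProb s hs z
  have hβ : 0 < S.PB s φ z := by
    rw [S.PB_apply hs, Pf]
    have h1 : 0 < (S.P s z).real (ball x (ρ / 2)) :=
      ENNReal.toReal_pos h0 (measure_ne_top _ _)
    exact h1.trans_le (measureReal_le_bmp hρ2 measurableSet_ball _)
  set β := S.PB s φ z with hβd
  have hev : ∀ᶠ y in 𝓝 z, β / 2 < S.PB s φ y :=
    (S.PB s φ).continuous.continuousAt.eventually (lt_mem_nhds (by linarith))
  obtain ⟨δ, hδ, hball⟩ := Metric.eventually_nhds_iff_ball.1 hev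
  have hl := hlow z δ hδ
  set a := limsup (fun t => S.Qmeas t z (ball z δ)) atTop with ha
  have hfr : ∃ᶠ t in atTop, a / 2 < S.Qmeas t z (ball z δ) := by
    refine frequently_lt_of_lt_limsup ?_ (by rw [← ha]; linarith)
    refine IsBoundedUnder.isCoboundedUnder_le ?_
    refine ⟨0, ?_⟩
    rw [eventually_map]
    filter_upwards [eventually_gt_atTop 0] with t ht
    rw [← S.Qm_real ht z measurableSet_ball]
    exact measureReal_nonneg
  refine ⟨β * a / 8, by positivity, ?_⟩
  have hlarge : ∀ᶠ T in atTop, 2 * s * ‖φ‖ / T < β * a / 8 := by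
    have h4 : Tendsto (fun T : ℝ => 2 * s * ‖φ‖ / T) atTop (𝓝 0) := tendsto_id.const_div_atTop _
    exact h4.eventually (gt_mem_nhds (by positivity))
  refine (hfr.and_eventually (hlarge.and (eventually_gt_atTop 0))).mono ?_
  rintro T ⟨h1, h2, hT⟩
  have := S.Qm_prob hT z
  rw [← S.Qm_real hT z measurableSet_ball] at h1
  have hnn : ∀ y, 0 ≤ S.PB s φ y := fun y => by
    rw [S.PB_apply hs, Pf]
    exact integral_nonneg fun w => bmp_nonneg _ _ _
  have e1 := mul_measureReal_le (S.Qm T z) (S.PB s φ) hnn (E := ball z δ) (c := β / 2)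
    (by linarith) (fun y hy => (hball y hy).le)
  rw [S.integral_Qm_bcf hT] at e1
  have e2 := (abs_le.1 (S.Qf_PB hs hT φ z)).2
  have e3 : S.Qf T φ z ≤ (S.Qm T z).real V := by
    rw [← S.integral_Qm_bcf hT]
    exact bmp_le_measureReal hρ2 hV.measurableSet hth _
  have e4 : (S.Qm T z).real (V ∩ S.acc z) = (S.Qm T z).real V := by
    rw [Measure.real, Measure.real]
    congr 1
    exact measure_inter_conull (S.Qm_acc_compl z T)
  rw [e4]
  have e5 : β / 2 * (a / 2) ≤ β / 2 * (S.Qm T z).real (ball z δ) :=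
    mul_le_mul_of_nonneg_left h1.le (by linarith)
  nlinarith

end Helpers

end MarkovFellerSemigroup

namespace MarkovFellerSemigroup

open ProbabilityTheory BoundedContinuousFunction

section Helpers

variable {X : Type*} [MetricSpace X] [CompleteSpace X]
  [TopologicalSpace.SeparableSpace X] [MeasurableSpace X] [BorelSpace X]

def Aset (r : ℝ) (F : ℕ → Set X) (k k' : ℕ) : Set X :=
  (thickening (3 * r) (F k))ᶜ ∩ cthickening (r / 4) (F k')

lemma Aset_closed (r : ℝ) (F : ℕ → Set X) (k k' : ℕ) : IsClosed (Aset r F k k') :=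
  isOpen_thickening.isClosed_compl.inter isClosed_cthickening

/-- bump around `F k` at scale `r` -/
noncomputable def bF {r : ℝ} (hr : 0 < r) (F : ℕ → Set X) (k : ℕ) : X →ᵇ ℝ :=
  bmp hr (cthickening r (F k))

lemma bF_mono {r : ℝ} (hr : 0 < r) {F : ℕ → Set X} (hF : Monotone F) {k k' : ℕ} (h : k ≤ k')
    (y : X) : bF hr F k y ≤ bF hr F k' y :=
  bmp_mono hr (cthickening_subset_of_subset r (hF h)) y

/-- bump around the union of the sets `A_i`, `i ∈ I` -/
noncomputable def GG {r : ℝ} (hr : 0 < r) (F : ℕ → Set X) (mm : ℕ → ℕ) (I : Set ℕ) : X →ᵇ ℝ :=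
  bmp (half_pos hr) (⋃ i ∈ I, Aset r F (mm i) (mm (i + 1)))

lemma geo1 {r : ℝ} (hr : 0 < r) (F : ℕ → Set X) {k k' : ℕ} {y : X}
    (hy : y ∈ thickening (r / 2) (Aset r F k k')) :
    bF hr F k' y = 1 ∧ y ∉ thickening (2 * r) (F k) := by
  obtain ⟨a, ⟨ha1, ha2⟩, hya⟩ := mem_thickening_iff.1 hy
  have ha2' := cthickening_subset_thickening' (show (0:ℝ) < r / 2 by linarith)
    (show r / 4 < r / 2 by linarith) (F k') ha2
  obtain ⟨w, hw, haw⟩ := mem_thickening_iff.1 ha2'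
  refine ⟨bmp_one hr (thickening_subset_cthickening _ _ (mem_thickening_iff.2 ⟨w, hw, ?_⟩)), ?_⟩
  · linarith [dist_triangle y a w]
  · intro hcon
    obtain ⟨v, hv, hyv⟩ := mem_thickening_iff.1 hcon
    apply ha1
    refine mem_thickening_iff.2 ⟨v, hv, ?_⟩
    linarith [dist_triangle a y v, dist_comm a y]

lemma geo2 {r : ℝ} (hr : 0 < r) (F : ℕ → Set X) {k : ℕ} {y : X}
    (hy : y ∉ thickening (2 * r) (F k)) : bF hr F k y = 0 := by
  refine bmp_zero hr fun h => hy ?_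
  have := thickening_cthickening_subset r hr.le (F k) h
  rwa [two_mul]

lemma GG_mem {r : ℝ} (hr : 0 < r) (F : ℕ → Set X) (mm : ℕ → ℕ) (I : Set ℕ) {y : X}
    (h : GG hr F mm I y ≠ 0) :
    ∃ i ∈ I, y ∈ thickening (r / 2) (Aset r F (mm i) (mm (i + 1))) := by
  have h1 : y ∈ thickening (r / 2) (⋃ i ∈ I, Aset r F (mm i) (mm (i + 1))) := by
    by_contra hc
    exact h (bmp_zero (half_pos hr) hc)
  obtain ⟨a, ha, hya⟩ := mem_thickening_iff.1 h1
  simp only [mem_iUnion] at ha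
  obtain ⟨i, hi, ha⟩ := ha
  exact ⟨i, hi, mem_thickening_iff.2 ⟨a, ha, hya⟩⟩

lemma GG_le {r : ℝ} (hr : 0 < r) {F : ℕ → Set X} (hF : Monotone F) {mm : ℕ → ℕ}
    (hm : StrictMono mm) (I : Set ℕ) {l n : ℕ} (hln : l ≤ n) (hI : ∀ i ∈ I, l ≤ i ∧ i < n)
    (y : X) : GG hr F mm I y + bF hr F (mm l) y ≤ bF hr F (mm n) y := by
  by_cases h : GG hr F mm I y = 0
  · rw [h, zero_add]
    exact bF_mono hr hF (hm.monotone hln) y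
  · obtain ⟨i, hi, hy⟩ := GG_mem hr F mm I h
    obtain ⟨h1, h2⟩ := geo1 hr F hy
    have h3 := geo2 hr F h2
    have h4 := bF_mono hr hF (hm.monotone (hI i hi).1) y
    have h5 := bF_mono hr hF (hm.monotone (Nat.succ_le_of_lt (hI i hi).2)) y
    have h6 : GG hr F mm I y ≤ 1 := bmp_le_one _ _ _
    simp only [Nat.succ_eq_add_one] at h5
    linarith

lemma GG_sum_le {r : ℝ} (hr : 0 < r) {F : ℕ → Set X} (hF : Monotone F) {mm : ℕ → ℕ}
    (hm : StrictMono mm) (J : Finset ℕ) (y : X) : ∑ i ∈ J, GG hr F mm {i} y ≤ 1 := by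
  have h1 : ∀ n, ∑ i ∈ Finset.range n, GG hr F mm {i} y ≤ bF hr F (mm n) y := by
    intro n
    induction n with
    | zero => rw [Finset.sum_range_zero]; exact bmp_nonneg _ _ _
    | succ n ih =>
      rw [Finset.sum_range_succ]
      have := GG_le hr hF hm {n} (Nat.le_succ n) (by simp) y
      linarith
  have h2 : J ⊆ Finset.range (J.sup id + 1) := by
    intro i hi
    rw [Finset.mem_range, Nat.lt_succ_iff]
    exact Finset.le_sup (f := id) hi
  calc ∑ i ∈ J, GG hr F mm {i} y ≤ ∑ i ∈ Finset.range (J.sup id + 1), GG hr F mm {i} y :=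
        Finset.sum_le_sum_of_subset_of_nonneg h2 (fun i _ _ => bmp_nonneg _ _ _)
    _ ≤ bF hr F (mm (J.sup id + 1)) y := h1 _
    _ ≤ 1 := bmp_le_one _ _ _

lemma GG_mono {r : ℝ} (hr : 0 < r) (F : ℕ → Set X) (mm : ℕ → ℕ) {I I' : Set ℕ} (h : I ⊆ I')
    (y : X) : GG hr F mm I y ≤ GG hr F mm I' y :=
  bmp_mono _ (biUnion_subset_biUnion_left h) y

lemma GG_union {r : ℝ} (hr : 0 < r) (F : ℕ → Set X) (mm : ℕ → ℕ) (I I' : Set ℕ)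
    (y : X) : GG hr F mm (I ∪ I') y ≤ GG hr F mm I y + GG hr F mm I' y := by
  unfold GG
  rw [biUnion_union]
  exact bmp_union _ _ _ y

lemma GG_tail {r : ℝ} (hr : 0 < r) {F : ℕ → Set X} (hF : Monotone F)
    (hFd : ∀ x : X, ∀ δ > (0:ℝ), ∃ k, x ∈ thickening δ (F k)) {mm : ℕ → ℕ}
    (hm : StrictMono mm) (y : X) :
    Tendsto (fun M : ℕ => GG hr F mm (Ici M) y) atTop (𝓝 0) := by
  obtain ⟨k, hk⟩ := hFd y (2 * r) (by linarith)
  refine tendsto_const_nhds.congr' ?_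
  filter_upwards [eventually_ge_atTop k] with M hM
  by_contra hne
  obtain ⟨i, hi, hy⟩ := GG_mem hr F mm _ (Ne.symm hne)
  refine (geo1 hr F hy).2 (thickening_subset_of_subset _ (hF ?_) hk)
  exact hM.trans (le_trans hi (hm.id_le i))

lemma Qf_tail (S : MarkovFellerSemigroup X) {r : ℝ} (hr : 0 < r) {F : ℕ → Set X} (hF : Monotone F)
    (hFd : ∀ x : X, ∀ δ > (0:ℝ), ∃ k, x ∈ thickening δ (F k)) {mm : ℕ → ℕ}
    (hm : StrictMono mm) {t : ℝ} (ht : 0 < t) (x : X) :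
    Tendsto (fun M : ℕ => S.Qf t (GG hr F mm (Ici M)) x) atTop (𝓝 0) := by
  have := S.Qm_prob ht x
  have h : Tendsto (fun M : ℕ => ∫ y, GG hr F mm (Ici M) y ∂(S.Qm t x)) atTop
      (𝓝 (∫ y, (0:ℝ) ∂(S.Qm t x))) := by
    refine tendsto_integral_of_dominated_convergence (fun _ => 1) ?_ (integrable_const _) ?_ ?_
    · intro n; exact (GG hr F mm (Ici n)).continuous.aestronglyMeasurable
    · intro n
      refine ae_of_all _ fun y => ?_
      exact ((GG hr F mm (Ici n)).norm_coe_le_norm y).trans (bmp_norm _ _)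
    · exact ae_of_all _ fun y => GG_tail hr hF hFd hm y
  simp only [integral_zero] at h
  exact h.congr fun n => S.integral_Qm_bcf ht x _

/-- Case A is impossible. -/
lemma caseA (S : MarkovFellerSemigroup X) {r : ℝ} (hr : 0 < r) {F : ℕ → Set X} (hF : Monotone F)
    {mm : ℕ → ℕ} (hm : StrictMono mm) (t : ℕ → ℝ) (ht : ∀ i, 0 < t i) (z : X) {E : Set X}
    {α c : ℝ} (hα : 0 < α) (hc : 0 < c) (hfr : ∃ᶠ T in atTop, α ≤ (S.Qm T z).real E)
    (hinf : {i | ∀ x ∈ E, c ≤ S.Qf (t i) (GG hr F mm {i}) x}.Infinite) : False := by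
  obtain ⟨N, hN⟩ := exists_nat_gt (2 / (c * α))
  obtain ⟨J, hJ, hcard⟩ := hinf.exists_subset_card_eq N
  rw [div_lt_iff₀ (by positivity)] at hN
  obtain ⟨T, hT1, hT2, hT3⟩ := (hfr.and_eventually ((eventually_gt_atTop 0).and
    (eventually_ge_atTop (∑ i ∈ J, 2 * t i)))).exists
  have := S.Qm_prob hT2 z
  have h1 : ∀ i ∈ J, c * α ≤ S.Qf T (GG hr F mm {i}) z + 2 * t i / T := by
    intro i hi
    have e1 := mul_measureReal_le (S.Qm T z) (S.QB (t i) (ht i) (GG hr F mm {i})) (fun y => by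
      have := S.Qm_prob (ht i) y
      rw [S.QB_apply, ← S.integral_Qm_bcf (ht i)]
      exact integral_nonneg fun w => bmp_nonneg _ _ _) (E := E) hc.le (fun y hy => by
        rw [S.QB_apply]; exact hJ hi y hy)
    rw [S.integral_Qm_bcf hT2] at e1
    have e2 := (abs_le.1 (S.Qf_QB (ht i) hT2 (GG hr F mm {i}) z)).2
    have e3 : 2 * t i * ‖GG hr F mm {i}‖ / T ≤ 2 * t i / T := by
      refine div_le_div_of_nonneg_right ?_ hT2.le
      have : ‖GG hr F mm {i}‖ ≤ 1 := bmp_norm _ _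
      nlinarith [ht i]
    have e4 := mul_le_mul_of_nonneg_left hT1 hc.le
    linarith
  have h2 := Finset.sum_le_sum h1
  rw [Finset.sum_const, hcard, Finset.sum_add_distrib, ← Finset.sum_div, nsmul_eq_mul,
    ← S.Qf_sum hT2] at h2
  have h3 : S.Qf T (∑ i ∈ J, GG hr F mm {i} : X →ᵇ ℝ) z ≤ 1 := by
    rw [← S.integral_Qm_bcf hT2]
    calc _ ≤ ∫ _, (1:ℝ) ∂(S.Qm T z) := by
          refine integral_mono (BoundedContinuousFunction.integrable _ _) (integrable_const _)
            fun y => ?_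
          have := GG_sum_le hr hF hm J y
          simpa using this
      _ = 1 := by simp
  have h4 : (∑ i ∈ J, 2 * t i) / T ≤ 1 := by
    rw [div_le_one hT2]; exact hT3
  linarith

end Helpers

end MarkovFellerSemigroup

namespace MarkovFellerSemigroup

open ProbabilityTheory BoundedContinuousFunction

section Helpers

variable {X : Type*} [MetricSpace X] [CompleteSpace X]
  [TopologicalSpace.SeparableSpace X] [MeasurableSpace X] [BorelSpace X]

lemma stepB (S : MarkovFellerSemigroup X) {r : ℝ} (hr : 0 < r) {F : ℕ → Set X} (hF : Monotone F)
    (hFd : ∀ x : X, ∀ δ > (0:ℝ), ∃ k, x ∈ thickening δ (F k))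
    {mm : ℕ → ℕ} (hm : StrictMono mm) (t : ℕ → ℝ) (ht : ∀ i, 0 < t i)
    {C V : Set X} (hC : IsClosed C) (L : ℕ → X → ℝ)
    (hL : ∀ k x, Tendsto (fun i => S.Qf (t i) (bF hr F k) x) atTop (𝓝 (L k x)))
    {η c : ℝ} (hη : 0 < η) (hLV : ∀ x ∈ V ∩ C, ∀ k, L k x - L (mm 0) x ≤ η)
    (hB : ∀ U, IsOpen U → U ⊆ V → (U ∩ C).Nonempty →
      ¬ {i | ∀ x ∈ U ∩ C, c ≤ S.Qf (t i) (GG hr F mm {i}) x}.Infinite)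
    (J : Finset ℕ) (M : ℕ) {B : Set X} (hBo : IsOpen B) (hBV : B ⊆ V) (hBne : (B ∩ C).Nonempty) :
    ∃ i M' : ℕ, ∃ W : Set X, M ≤ i ∧ i < M' ∧ IsOpen W ∧ W ⊆ B ∧ (W ∩ C).Nonempty ∧
      ∀ x ∈ W, S.Qf (t i) (GG hr F mm (J : Set ℕ)) x < 3 * η ∧ S.Qf (t i) (GG hr F mm {i}) x < c ∧
        S.Qf (t i) (GG hr F mm (Ici M')) x < η := by
  let E : ℕ → Set X := fun j => {x | ∀ i, j ≤ i → S.Qf (t i) (GG hr F mm (J : Set ℕ)) x ≤ 2 * η}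
  have hE : ∀ j, IsClosed (E j) := by
    intro j
    have : E j = ⋂ i, ⋂ (_ : j ≤ i), {x | S.Qf (t i) (GG hr F mm (J : Set ℕ)) x ≤ 2 * η} := by
      ext x; simp [E]
    rw [this]
    exact isClosed_iInter fun i => isClosed_iInter fun _ =>
      isClosed_le (S.continuous_Qf (ht i) _) continuous_const
  have hcov : ∀ x ∈ B ∩ C, ∃ j, x ∈ E j := by
    intro x hx
    let n := J.sup id + 1
    have h1 : ∀ i, S.Qf (t i) (GG hr F mm (J : Set ℕ)) x ≤
        S.Qf (t i) (bF hr F (mm n)) x - S.Qf (t i) (bF hr F (mm 0)) x := by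
      intro i
      have := S.Qf_mono (ht i) x (f := GG hr F mm (J : Set ℕ) + bF hr F (mm 0))
        (g := bF hr F (mm n)) (fun y => by
          have := GG_le hr hF hm (J : Set ℕ) (Nat.zero_le n) (fun i hi => ⟨Nat.zero_le _,
            Nat.lt_succ_of_le (Finset.le_sup (f := id) hi)⟩) y
          simpa using this)
      rw [S.Qf_add (ht i)] at this
      linarith
    have h2 := (hL (mm n) x).sub (hL (mm 0) x)
    have h3 := hLV x ⟨hBV hx.1, hx.2⟩ (mm n)
    have h4 := h2.eventually (gt_mem_nhds (show L (mm n) x - L (mm 0) x < 2 * η by linarith))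
    obtain ⟨j, hj⟩ := eventually_atTop.1 h4
    exact ⟨j, fun i hi => (h1 i).trans (hj i hi).le⟩
  obtain ⟨j, U, hU, hUB, hUne, hUE⟩ := baire_closed hC hBo hBne E hE hcov
  have hfin := hB U hU (hUB.trans hBV) hUne
  rw [Set.not_infinite] at hfin
  obtain ⟨b, hb⟩ := hfin.bddAbove
  let i := max (max M j) (b + 1)
  have hi : ∃ x ∈ U ∩ C, S.Qf (t i) (GG hr F mm {i}) x < c := by
    by_contra! hcon
    have := hb (show i ∈ _ from hcon)
    have h2 : b + 1 ≤ i := le_max_right _ _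
    omega
  obtain ⟨x, hx, hxc⟩ := hi
  have hji : j ≤ i := (le_max_right _ _).trans (le_max_left _ _)
  have h1 := hUE hx i hji
  have h2 := (S.Qf_tail hr hF hFd hm (ht i) x).eventually (gt_mem_nhds hη)
  obtain ⟨M', hM', hM'i⟩ := (h2.and (eventually_gt_atTop i)).exists
  refine ⟨i, M', U ∩ ({x | S.Qf (t i) (GG hr F mm (J : Set ℕ)) x < 3 * η} ∩
    ({x | S.Qf (t i) (GG hr F mm {i}) x < c} ∩ {x | S.Qf (t i) (GG hr F mm (Ici M')) x < η})),
    (le_max_left _ _).trans (le_max_left _ _), hM'i, ?_, ?_, ?_, ?_⟩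
  · exact hU.inter ((isOpen_lt (S.continuous_Qf (ht i) _) continuous_const).inter
      ((isOpen_lt (S.continuous_Qf (ht i) _) continuous_const).inter
      (isOpen_lt (S.continuous_Qf (ht i) _) continuous_const)))
  · exact inter_subset_left.trans hUB
  · exact ⟨x, ⟨hx.1, lt_of_le_of_lt h1 (by linarith), hxc, hM'⟩, hx.2⟩
  · rintro y ⟨-, h1, h2, h3⟩
    exact ⟨h1, h2, h3⟩

lemma caseB (S : MarkovFellerSemigroup X) {r : ℝ} (hr : 0 < r) {F : ℕ → Set X} (hF : Monotone F)
    (hFd : ∀ x : X, ∀ δ > (0:ℝ), ∃ k, x ∈ thickening δ (F k))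
    {mm : ℕ → ℕ} (hm : StrictMono mm) (t : ℕ → ℝ) (ht : ∀ i, 0 < t i)
    (htt : Tendsto t atTop atTop)
    {C V : Set X} (hC : IsClosed C) (hV : IsOpen V) (L : ℕ → X → ℝ)
    (hL : ∀ k x, Tendsto (fun i => S.Qf (t i) (bF hr F k) x) atTop (𝓝 (L k x)))
    {η c : ℝ} (hη : 0 < η) (hLV : ∀ x ∈ V ∩ C, ∀ k, L k x - L (mm 0) x ≤ η)
    (hB : ∀ U, IsOpen U → U ⊆ V → (U ∩ C).Nonempty →
      ¬ {i | ∀ x ∈ U ∩ C, c ≤ S.Qf (t i) (GG hr F mm {i}) x}.Infinite)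
    (z' : X) (hz' : z' ∈ V ∩ C) (hEC : S.CesaroEvContAt z')
    (hmass : ∀ i, c + 5 * η ≤ (S.Qm (t i) z').real (Aset r F (mm i) (mm (i + 1)))) : False := by
  classical
  have : SecondCountableTopology X := UniformSpace.secondCountable_of_separable X
  obtain ⟨bs, hbc, -, hbasis⟩ := TopologicalSpace.exists_countable_basis X
  have hbne : bs.Nonempty := by
    obtain ⟨v, hv, -⟩ := hbasis.exists_subset_of_mem_open (mem_univ z') isOpen_univ
    exact ⟨v, hv⟩
  obtain ⟨u, hu⟩ := hbc.exists_eq_range hbne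
  let Bn : ℕ → Set X := fun n =>
    if ((u (Nat.unpair n).1 ∩ V) ∩ C).Nonempty then u (Nat.unpair n).1 ∩ V else V
  have huo : ∀ j, IsOpen (u j) := fun j => hbasis.isOpen (by rw [hu]; exact ⟨j, rfl⟩)
  have hBo : ∀ n, IsOpen (Bn n) := by
    intro n; simp only [Bn]; split_ifs
    · exact (huo _).inter hV
    · exact hV
  have hBV : ∀ n, Bn n ⊆ V := by
    intro n; simp only [Bn]; split_ifs
    · exact inter_subset_right
    · exact subset_rfl
  have hBne : ∀ n, (Bn n ∩ C).Nonempty := by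
    intro n; simp only [Bn]; split_ifs with h
    · exact h
    · exact ⟨z', hz'⟩
  choose fi fM fW h1 h2 h3 h4 h5 h6 using fun (n : ℕ) (q : Finset ℕ × ℕ) =>
    S.stepB hr hF hFd hm t ht hC L hL hη hLV hB q.1 q.2 (hBo n) (hBV n) (hBne n)
  let st : ℕ → Finset ℕ × ℕ := fun n => Nat.rec (∅, 0)
    (fun n q => (insert (fi n q) q.1, fM n q)) n
  let ii : ℕ → ℕ := fun n => fi n (st n)
  let W : ℕ → Set X := fun n => fW n (st n)
  have st1 : ∀ n, (st (n + 1)).1 = insert (ii n) (st n).1 := fun n => rfl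
  have st2 : ∀ n, (st (n + 1)).2 = fM n (st n) := fun n => rfl
  have hlo : ∀ n, (st n).2 ≤ ii n := fun n => h1 n (st n)
  have hhi : ∀ n, ii n < (st (n + 1)).2 := fun n => h2 n (st n)
  have hsm : StrictMono ii := strictMono_nat_of_lt_succ fun n => (hhi n).trans_le (hlo (n + 1))
  have hJ : ∀ n k, k < n → ii k ∈ (st n).1 := by
    intro n
    induction n with
    | zero => intro k hk; omega
    | succ n ih =>
      intro k hk
      rw [st1, Finset.mem_insert]
      rcases Nat.lt_succ_iff_lt_or_eq.1 hk with h | h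
      · exact Or.inr (ih k h)
      · left; rw [h]
  let I : Set ℕ := range ii
  have hI : ∀ n, I ⊆ (((st n).1 : Set ℕ) ∪ {ii n}) ∪ Ici (st (n + 1)).2 := by
    rintro n _ ⟨k, rfl⟩
    rcases lt_trichotomy k n with h | h | h
    · exact Or.inl (Or.inl (hJ n k h))
    · left; right; rw [h]; rfl
    · right
      exact (hlo (n + 1)).trans (hsm.monotone h)
  have hG : ∀ n, ∀ x ∈ W n, S.Qf (t (ii n)) (GG hr F mm I) x < c + 4 * η := by
    intro n x hx
    obtain ⟨e1, e2, e3⟩ := h6 n (st n) x hx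
    have := S.Qf_mono (ht (ii n)) x (f := GG hr F mm I)
      (g := (GG hr F mm ((st n).1 : Set ℕ) + GG hr F mm {ii n}) + GG hr F mm (Ici (st (n + 1)).2))
      (fun y => by
        have a1 := GG_mono hr F mm (hI n) y
        have a2 := GG_union hr F mm (((st n).1 : Set ℕ) ∪ {ii n}) (Ici (st (n + 1)).2) y
        have a3 := GG_union hr F mm ((st n).1 : Set ℕ) {ii n} y
        simp only [BoundedContinuousFunction.coe_add, Pi.add_apply]
        linarith)
    rw [S.Qf_add (ht _), S.Qf_add (ht _)] at this
    have e3' : S.Qf (t (ii n)) (GG hr F mm (Ici (st (n + 1)).2)) x < η := e3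
    have e2' : S.Qf (t (ii n)) (GG hr F mm {ii n}) x < c := e2
    have e1' : S.Qf (t (ii n)) (GG hr F mm ((st n).1 : Set ℕ)) x < 3 * η := e1
    linarith
  have hz : ∀ n, c + 5 * η ≤ S.Qf (t (ii n)) (GG hr F mm I) z' := by
    intro n
    have := S.Qm_prob (ht (ii n)) z'
    refine (hmass (ii n)).trans ?_
    rw [← S.integral_Qm_bcf (ht _)]
    refine (measureReal_le_bmp (half_pos hr) (Aset_closed _ _ _ _).measurableSet _).trans ?_
    refine integral_mono (BoundedContinuousFunction.integrable _ _)
      (BoundedContinuousFunction.integrable _ _) fun y => ?_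
    refine bmp_mono _ ?_ y
    exact subset_biUnion_of_mem (u := fun i => Aset r F (mm i) (mm (i + 1))) ⟨n, rfl⟩
  have hec := S.ec_ev hEC (GG hr F mm I) (bmp_lip _ _) hη
  obtain ⟨U, hU, hUo, hzU⟩ := _root_.eventually_nhds_iff.1 hec
  obtain ⟨x, hx, hxO⟩ := baire_dense hC (hUo.inter hV) ⟨z', ⟨hzU, hz'.1⟩, hz'.2⟩
    (fun N => ⋃ n, ⋃ (_ : N ≤ n), W n)
    (fun N => isOpen_iUnion fun n => isOpen_iUnion fun _ => h3 n (st n))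
    (fun N O hO hOB hOne => by
      obtain ⟨y, hyO, hyC⟩ := hOne
      obtain ⟨v, hv, hyv, hvO⟩ := hbasis.exists_subset_of_mem_open hyO hO
      rw [hu] at hv
      obtain ⟨j, rfl⟩ := hv
      let n := Nat.pair j N
      have hn : (Nat.unpair n).1 = j := by simp [n]
      have hBn : Bn n = u j ∩ V := by
        simp only [Bn, hn]
        rw [if_pos ⟨y, ⟨hyv, (hOB hyO).2⟩, hyC⟩]
      obtain ⟨w, hwW, hwC⟩ := h5 n (st n)
      have hwB : w ∈ Bn n := h4 n (st n) hwW
      rw [hBn] at hwB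
      refine ⟨w, ⟨hvO hwB.1, hwC⟩, ?_⟩
      simp only [mem_iUnion]
      exact ⟨n, Nat.right_le_pair j N, hwW⟩)
  have hev := (htt.comp hsm.tendsto_atTop).eventually (hU x hx.1.1)
  obtain ⟨N, hN⟩ := eventually_atTop.1 hev
  have := hxO N
  simp only [mem_iUnion] at this
  obtain ⟨n, hNn, hxn⟩ := this
  have e1 := hG n x hxn
  have e2 := hz n
  have e3 := abs_lt.1 (hN n hNn)
  simp only [Function.comp] at e3
  linarith [e3.1]

end Helpers

end MarkovFellerSemigroup

namespace MarkovFellerSemigroup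

open ProbabilityTheory BoundedContinuousFunction

section Helpers

variable {X : Type*} [MetricSpace X] [CompleteSpace X]
  [TopologicalSpace.SeparableSpace X] [MeasurableSpace X] [BorelSpace X]

lemma core (S : MarkovFellerSemigroup X) (h : ∀ x, S.CesaroEvContAt x) (z : X)
    (hlow : ∀ x : X, ∀ ε > (0:ℝ), 0 < limsup (fun t => S.Qmeas t x (ball z ε)) atTop)
    {r : ℝ} (hr : 0 < r) (hr3 : 0 < 3 * r) {F : ℕ → Set X} (hF : Monotone F)
    (hFd : ∀ x : X, ∀ δ > (0:ℝ), ∃ k, x ∈ thickening δ (F k))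
    (τ : ℕ → ℝ) (hpos : ∀ n, 0 < τ n) (hτ : Tendsto τ atTop atTop)
    (L L3 : ℕ → X → ℝ) (hLc : ∀ k, Continuous (L k))
    (hL : ∀ k x, Tendsto (fun n => S.Qf (τ n) (bF hr F k) x) atTop (𝓝 (L k x)))
    (hL3 : ∀ k x, Tendsto (fun n => S.Qf (τ n) (bF hr3 F k) x) atTop (𝓝 (L3 k x)))
    {V : Set X} (hV : IsOpen V) (hVne : (V ∩ S.acc z).Nonempty) {ε : ℝ} (hε : 0 < ε)
    (hbad : ∀ x ∈ V ∩ S.acc z, ∀ k, L3 k x ≤ 1 - 2 * ε) : False := by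
  have hη : 0 < ε / 20 := by linarith
  -- choose an almost maximising point
  have hL1 : ∀ k x, L k x ≤ 1 := fun k x => le_of_tendsto (hL k x)
    (Eventually.of_forall fun n => ((le_abs_self _).trans (S.abs_Qf_le (hpos n) x _)).trans
      (bmp_norm _ _))
  let R : Set ℝ := {a | ∃ x ∈ V ∩ S.acc z, ∃ k, a = L k x}
  have hRb : BddAbove R := ⟨1, by rintro _ ⟨x, -, k, rfl⟩; exact hL1 k x⟩
  have hRne : R.Nonempty := by
    obtain ⟨x, hx⟩ := hVne
    exact ⟨_, x, hx, 0, rfl⟩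
  obtain ⟨_, ⟨z', hz', m0, rfl⟩, hz'L⟩ := exists_lt_of_lt_csSup hRne
    (show sSup R - ε / 20 < sSup R by linarith)
  let V1 : Set X := V ∩ {x | sSup R - ε / 20 < L m0 x}
  have hV1 : IsOpen V1 := hV.inter (isOpen_lt continuous_const (hLc m0))
  have hLV : ∀ x ∈ V1 ∩ S.acc z, ∀ k, L k x - L m0 x ≤ ε / 20 := by
    intro x hx k
    have e1 : L k x ≤ sSup R := le_csSup hRb ⟨x, ⟨hx.1.1, hx.2⟩, k, rfl⟩
    have e2 : sSup R - ε / 20 < L m0 x := hx.1.2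
    linarith
  -- build the sequences
  have hstep : ∀ m i : ℕ, ∃ m' n : ℕ, m < m' ∧ i ≤ n ∧
      ε / 2 ≤ (S.Qm (τ n) z').real (Aset r F m m') := by
    intro m i
    have e1 := (hL3 m z').eventually
      (gt_mem_nhds (show L3 m z' < 1 - ε by linarith [hbad z' hz' m]))
    obtain ⟨n, hn, hin⟩ := (e1.and (eventually_ge_atTop i)).exists
    have := S.Qm_prob (hpos n) z'
    have e2 : (S.Qm (τ n) z').real (cthickening (3 * r) (F m)) ≤ 1 - ε := by
      refine le_trans ?_ hn.le
      rw [← S.integral_Qm_bcf (hpos n)]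
      exact measureReal_le_bmp hr3 isClosed_cthickening.measurableSet _
    have e3 : ε ≤ (S.Qm (τ n) z').real (thickening (3 * r) (F m))ᶜ := by
      rw [probReal_compl_eq_one_sub isOpen_thickening.measurableSet]
      have := measureReal_mono (μ := S.Qm (τ n) z') (thickening_subset_cthickening (3 * r) (F m))
      linarith
    have hun : (⋃ k, Aset r F m k) = (thickening (3 * r) (F m))ᶜ := by
      unfold Aset
      rw [← inter_iUnion]
      refine inter_eq_left.2 fun x _ => ?_
      obtain ⟨k, hk⟩ := hFd x (r / 4) (by linarith)
      exact mem_iUnion.2 ⟨k, thickening_subset_cthickening _ _ hk⟩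
    have hmono : Monotone (fun k => Aset r F m k) := fun a b hab =>
      inter_subset_inter_right _ (cthickening_subset_of_subset _ (hF hab))
    have e4 : Tendsto (fun k => (S.Qm (τ n) z').real (Aset r F m k)) atTop
        (𝓝 ((S.Qm (τ n) z').real (thickening (3 * r) (F m))ᶜ)) := by
      have := tendsto_measure_iUnion_atTop (μ := S.Qm (τ n) z') hmono
      rw [hun] at this
      exact (ENNReal.tendsto_toReal (measure_ne_top _ _)).comp this
    have e5 := e4.eventually (lt_mem_nhds (show ε / 2 < _ from lt_of_lt_of_le (by linarith) e3))
    obtain ⟨m', h1, h2⟩ := (e5.and (eventually_gt_atTop m)).exists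
    exact ⟨m', n, h2, hin, h1.le⟩
  choose fm fn hm1 hn1 hmass using hstep
  let mm : ℕ → ℕ := fun i => Nat.rec m0 (fun i m => fm m i) i
  have mm0 : mm 0 = m0 := rfl
  have mms : ∀ i, mm (i + 1) = fm (mm i) i := fun i => rfl
  have hm : StrictMono mm := strictMono_nat_of_lt_succ fun i => by rw [mms]; exact hm1 _ _
  let nn : ℕ → ℕ := fun i => fn (mm i) i
  have hnn : Tendsto nn atTop atTop := tendsto_atTop_mono (fun i => hn1 (mm i) i) tendsto_id
  refine S.caseB hr hF hFd hm (fun i => τ (nn i)) (fun i => hpos _) (hτ.comp hnn)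
    (S.acc_closed z) hV1 L (fun k x => (hL k x).comp hnn) (c := ε / 4) hη
    (by rw [mm0]; exact hLV) ?_ z' ⟨⟨hz'.1, hz'L⟩, hz'.2⟩ (h z') ?_
  · intro U hU hUV hUne hinf
    obtain ⟨α, hα, hfr⟩ := S.acc_rec z hlow hU hUne
    exact S.caseA hr hF hm (fun i => τ (nn i)) (fun i => hpos _) z hα
      (show 0 < ε / 4 by linarith) hfr hinf
  · intro i
    have := hmass (mm i) i
    rw [mms]
    change _ ≤ (S.Qm (τ (fn (mm i) i)) z').real _
    linarith

lemma exists_invariant (S : MarkovFellerSemigroup X) (h : ∀ x, S.CesaroEvContAt x) (z : X)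
    (hlow : ∀ x : X, ∀ ε > (0:ℝ), 0 < limsup (fun t => S.Qmeas t x (ball z ε)) atTop) :
    ∃ μ, S.Invariant μ := by
  have : Nonempty X := ⟨z⟩
  let d := TopologicalSpace.denseSeq X
  have hd : DenseRange d := TopologicalSpace.denseRange_denseSeq X
  let F : ℕ → Set X := fun m => d '' (Iic m)
  have hF : Monotone F := fun a b hab => image_mono (Iic_subset_Iic.2 hab)
  have hFfin : ∀ m, (F m).Finite := fun m => (finite_Iic m).image d
  have hFd : ∀ x : X, ∀ δ > (0:ℝ), ∃ k, x ∈ thickening δ (F k) := by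
    intro x δ hδ
    obtain ⟨k, hk⟩ := hd.exists_dist_lt x hδ
    exact ⟨k, mem_thickening_iff.2 ⟨d k, ⟨k, mem_Iic.2 le_rfl, rfl⟩, hk⟩⟩
  have hrp : ∀ p : ℕ, (0:ℝ) < (1 / 3) ^ p := fun p => by positivity
  obtain ⟨φ, hφ, L, hLc, hL⟩ := S.exists_conv_subseq h
    (fun q : ℕ × ℕ => bF (hrp q.1) F q.2) (fun q => bmp_lip _ _)
    (fun n : ℕ => (n:ℝ) + 1) tendsto_natCast_succ
  let τ : ℕ → ℝ := fun n => (φ n : ℝ) + 1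
  have hpos : ∀ n, 0 < τ n := fun n => by positivity
  have hτ : Tendsto τ atTop atTop := tendsto_natCast_succ.comp hφ.tendsto_atTop
  have hL' : ∀ p k x, Tendsto (fun n => S.Qf (τ n) (bF (hrp p) F k) x) atTop (𝓝 (L (p, k) x)) :=
    fun p k x => hL (p, k) x
  -- density
  obtain ⟨x, -, hx⟩ := baire_dense (S.acc_closed z) isOpen_univ ⟨z, mem_univ z, S.self_mem_acc z⟩
    (fun q => ⋃ m, {x | 1 - 1 / (((Nat.unpair q).2 : ℝ) + 1) < L ((Nat.unpair q).1, m) x})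
    (fun q => isOpen_iUnion fun m => isOpen_lt continuous_const (hLc _))
    (fun q V hV _ hVne => by
      by_contra hcon
      set p := (Nat.unpair q).1
      set k := (Nat.unpair q).2
      have e3 : (3:ℝ) * (1 / 3) ^ (p + 1) = (1 / 3) ^ p := by rw [pow_succ]; ring
      refine S.core h z hlow (hrp (p + 1)) (by positivity) hF hFd τ hpos hτ
        (fun m => L (p + 1, m)) (fun m => L (p, m)) (fun m => hLc _) (hL' (p + 1))
        ?_ hV hVne (ε := 1 / ((k : ℝ) + 1) / 2) (by positivity) ?_
      · intro m y
        have := hL' p m y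
        have e : bF (show (0:ℝ) < 3 * (1 / 3) ^ (p + 1) by positivity) F m = bF (hrp p) F m := by
          unfold bF bmp
          simp only [e3]
        rw [e]
        exact this
      · intro y hy m
        by_contra hlt
        apply hcon
        refine ⟨y, hy, mem_iUnion.2 ⟨m, ?_⟩⟩
        change 1 - 1 / ((k : ℝ) + 1) < L (p, m) y
        push Not at hlt
        have : 2 * (1 / ((k : ℝ) + 1) / 2) = 1 / ((k : ℝ) + 1) := by ring
        linarith)
  have hx' : ∀ p : ℕ, ∀ δ > (0:ℝ), ∃ m, 1 - δ < L (p, m) x := by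
    intro p δ hδ
    obtain ⟨k, hk⟩ := exists_nat_one_div_lt hδ
    have := hx (Nat.pair p k)
    simp only [Nat.unpair_pair, mem_iUnion] at this
    obtain ⟨m, hm⟩ := this
    have hm' : 1 - 1 / ((k : ℝ) + 1) < L (p, m) x := hm
    exact ⟨m, by linarith⟩
  -- uniform mass near finite sets
  have hmass : ∀ p : ℕ, ∀ δ > (0:ℝ), ∃ m, ∀ n,
      1 - δ ≤ (S.Qm (τ n) x).real (cthickening (2 * (1 / 3) ^ p) (F m)) := by
    intro p δ hδ
    obtain ⟨m, hm⟩ := hx' p δ hδ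
    have hmono : ∀ a b, a ≤ b → cthickening (2 * (1 / 3 : ℝ) ^ p) (F a) ⊆
        cthickening (2 * (1 / 3) ^ p) (F b) := fun a b hab =>
      cthickening_subset_of_subset _ (hF hab)
    have e1 := (hL' p m x).eventually (lt_mem_nhds hm)
    obtain ⟨N, hN⟩ := eventually_atTop.1 e1
    have e2 : ∀ n, ∀ᶠ k in atTop,
        1 - δ ≤ (S.Qm (τ n) x).real (cthickening (2 * (1 / 3) ^ p) (F k)) := by
      intro n
      have := S.Qm_prob (hpos n) x
      have t1 := tendsto_measure_iUnion_atTop (μ := S.Qm (τ n) x)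
        (s := fun k => cthickening (2 * (1 / 3 : ℝ) ^ p) (F k)) (fun a b hab => hmono a b hab)
      have hun : (⋃ k, cthickening (2 * (1 / 3 : ℝ) ^ p) (F k)) = univ := by
        refine eq_univ_of_forall fun y => ?_
        obtain ⟨k, hk⟩ := hFd y (2 * (1 / 3) ^ p) (by positivity)
        exact mem_iUnion.2 ⟨k, thickening_subset_cthickening _ _ hk⟩
      rw [hun, measure_univ] at t1
      have t2 := (ENNReal.tendsto_toReal ENNReal.one_ne_top).comp t1
      exact (t2.eventually (lt_mem_nhds (show 1 - δ < (1 : ℝ≥0∞).toReal by simpa using hδ))).mono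
        fun k hk => hk.le
    have e3 : ∀ᶠ k in atTop, ∀ n ∈ Finset.range N,
        1 - δ ≤ (S.Qm (τ n) x).real (cthickening (2 * (1 / 3) ^ p) (F k)) :=
      (Finset.eventually_all _).2 fun n _ => e2 n
    obtain ⟨k, hk, hmk⟩ := (e3.and (eventually_ge_atTop m)).exists
    refine ⟨k, fun n => ?_⟩
    by_cases hn : n < N
    · exact hk n (Finset.mem_range.2 hn)
    · have := S.Qm_prob (hpos n) x
      have a1 := hN n (not_lt.1 hn)
      have a2 : S.Qf (τ n) (bF (hrp p) F m) x ≤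
          (S.Qm (τ n) x).real (cthickening (2 * (1 / 3) ^ p) (F m)) := by
        rw [← S.integral_Qm_bcf (hpos n)]
        refine bmp_le_measureReal _ isClosed_cthickening.measurableSet ?_ _
        refine (thickening_cthickening_subset _ (hrp p).le (F m)).trans ?_
        rw [← two_mul]
        exact thickening_subset_cthickening _ _
      have a3 := measureReal_mono (μ := S.Qm (τ n) x) (hmono m k hmk)
      linarith
  obtain ⟨-, -, μ, hμ, -⟩ := S.exists_invariant_of_tight x τ hpos hτ (fun ε hε => by
    choose m hm using fun p : ℕ => hmass p (ε / 2 / 2 ^ p) (by positivity)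
    let K : Set X := ⋂ p, cthickening (2 * (1 / 3 : ℝ) ^ p) (F (m p))
    have hKc : IsClosed K := isClosed_iInter fun p => isClosed_cthickening
    refine ⟨K, isCompact_iff_totallyBounded_isComplete.2 ⟨?_, hKc.isComplete⟩, fun n => ?_⟩
    · rw [Metric.totallyBounded_iff]
      intro δ hδ
      obtain ⟨p, hp⟩ := exists_pow_lt_of_lt_one (show 0 < δ / 3 by linarith)
        (show (1 / 3 : ℝ) < 1 by norm_num)
      refine ⟨F (m p), hFfin _, fun y hy => ?_⟩
      have hy1 := mem_iInter.1 hy p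
      have hy2 := cthickening_subset_thickening' hδ
        (show 2 * (1 / 3 : ℝ) ^ p < δ by linarith [hrp p]) (F (m p)) hy1
      rwa [thickening_eq_biUnion_ball] at hy2
    · have := S.Qm_prob (hpos n) x
      have hc : (S.Qm (τ n) x) Kᶜ ≤ ENNReal.ofReal ε := by
        have e1 : Kᶜ = ⋃ p, (cthickening (2 * (1 / 3 : ℝ) ^ p) (F (m p)))ᶜ := by
          simp only [K, compl_iInter]
        rw [e1]
        refine (measure_iUnion_le _).trans ?_
        have e2 : ∀ p, (S.Qm (τ n) x) (cthickening (2 * (1 / 3 : ℝ) ^ p) (F (m p)))ᶜ ≤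
            ENNReal.ofReal (ε / 2 / 2 ^ p) := by
          intro p
          rw [← ofReal_measureReal]
          refine ENNReal.ofReal_le_ofReal ?_
          rw [probReal_compl_eq_one_sub isClosed_cthickening.measurableSet]
          linarith [hm p n]
        refine (ENNReal.tsum_le_tsum e2).trans ?_
        rw [← ENNReal.ofReal_tsum_of_nonneg (fun p => by positivity) (summable_geometric_two' ε),
          tsum_geometric_two']
      have h1 : (S.Qm (τ n) x).real Kᶜ ≤ ε := ENNReal.toReal_le_of_le_ofReal hε.le hc
      rw [probReal_compl_eq_one_sub hKc.measurableSet] at h1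
      linarith)
  exact ⟨μ, hμ⟩

end Helpers

end MarkovFellerSemigroup

namespace MarkovFellerSemigroup

variable {X : Type*} [MetricSpace X] [CompleteSpace X]
  [TopologicalSpace.SeparableSpace X] [MeasurableSpace X] [BorelSpace X]

theorem unique_invariant_of_lower_bound (S : MarkovFellerSemigroup X)
    (h : ∀ z : X, S.CesaroEvContAt z) (z : X)
    (hlow : ∀ x : X, ∀ ε > (0:ℝ),
      0 < limsup (fun t => S.Qmeas t x (ball z ε)) atTop) :
    ∃ μs : Measure X, S.Invariant μs ∧ (∀ ν : Measure X, S.Invariant ν → ν = μs) ∧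
      z ∈ msupp μs ∧
      ∀ ν : Measure X, IsProbabilityMeasure ν → msupp ν ⊆ S.Tset →
        S.QWeakLimM ν μs := by
  obtain ⟨μs, hμs⟩ := S.exists_invariant h z hlow
  have huniq : ∀ ν : Measure X, S.Invariant ν → ν = μs := fun ν hν =>
    S.invariant_unique h z hlow hμs hν
  exact ⟨μs, hμs, huniq, S.mem_msupp z hlow hμs, fun ν hν hs =>
    S.conv_measure huniq hμs ν hν hs⟩

end MarkovFellerSemigroup
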